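/- Let {G_α : α ∈ [0,1]} be a family of n×n real matrices such that for every α, G_α is an inverse M-matrix (G_α has nonnegative entries and (G_α)⁻¹ has nonpositive off-diagonal entries) with positive definite symmetric part, and such that each entry α ↦ G_{α,ij} is differentiable on [0,1] with derivative of constant sign in α. For each α let ℓ_α be a 1-permanental random vector with kernel G_α. Let f : ℝ₊ⁿ → ℝ be twice continuously differentiable, with f and all its first and second partial derivatives of subexponential growth. Assume: for each i, either ( dG_{α,ii}/dα ≥ 0 for all α and ∂ᵢf(l) + lᵢ·∂ᵢᵢf(l) ≥ 0 for all l ∈ ℝ₊ⁿ ) or ( dG_{α,ii}/dα ≤ 0 for all α and ∂ᵢf(l) + lᵢ·∂ᵢᵢf(l) ≤ 0 for all l ); and for each i ≠ j, either ( dG_{α,ij}/dα ≥ 0 for all α and ∂ᵢⱼf(l) ≥ 0 for all l ) or ( dG_{α,ij}/dα ≤ 0 for all α and ∂ᵢⱼf(l) ≤ 0 for all l ). Then E[f(ℓ₁)] ≥ E[f(ℓ₀)]. -/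

import Mathlib

open Matrix MeasureTheory Filter

/-- A function on `ℝ₊ⁿ` has subexponential growth: `log(1+|f(l)|)/‖l‖ → 0` as `‖l‖ → ∞` within
the nonnegative orthant. -/
def HasSubexpGrowth {n : ℕ} (f : (Fin n → ℝ) → ℝ) : Prop :=
  Tendsto (fun l : Fin n → ℝ => Real.log (1 + |f l|) / ‖l‖)
    (cocompact (Fin n → ℝ) ⊓ Filter.principal {l | ∀ i, 0 ≤ l i}) (nhds 0)

/-- The partial derivative `∂ᵢ f`. -/
noncomputable def pd {n : ℕ} (i : Fin n) (f : (Fin n → ℝ) → ℝ) (l : Fin n → ℝ) : ℝ :=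
  fderiv ℝ f l (Pi.single i 1)

/-- The second partial derivative `∂ᵢⱼ f`. -/
noncomputable def pd2 {n : ℕ} (i j : Fin n) (f : (Fin n → ℝ) → ℝ) (l : Fin n → ℝ) : ℝ :=
  fderiv ℝ (fun x => fderiv ℝ f x (Pi.single i 1)) l (Pi.single j 1)

namespace KP

open scoped ENNReal NNReal

variable {σ : Type*}

/-- weighted l1 norm of a power series -/
noncomputable def wN (w : (σ →₀ ℕ) → ℝ≥0∞) (Y : MvPowerSeries σ ℝ) : ℝ≥0∞ :=
  ∑' m, ‖MvPowerSeries.coeff m Y‖ₑ * w m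

lemma wN_add_le (w : (σ →₀ ℕ) → ℝ≥0∞) (Y Z : MvPowerSeries σ ℝ) :
    wN w (Y + Z) ≤ wN w Y + wN w Z := by
  unfold wN
  rw [← ENNReal.tsum_add]
  refine ENNReal.tsum_le_tsum fun m => ?_
  rw [← add_mul, map_add]
  gcongr
  exact enorm_add_le _ _

lemma wN_neg (w : (σ →₀ ℕ) → ℝ≥0∞) (Y : MvPowerSeries σ ℝ) : wN w (-Y) = wN w Y := by
  simp [wN]

lemma wN_sub_le (w : (σ →₀ ℕ) → ℝ≥0∞) (Y Z : MvPowerSeries σ ℝ) :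
    wN w (Y - Z) ≤ wN w Y + wN w Z := by
  rw [sub_eq_add_neg, ← wN_neg w Z]; exact wN_add_le _ _ _

lemma wN_zero (w : (σ →₀ ℕ) → ℝ≥0∞) : wN w (0 : MvPowerSeries σ ℝ) = 0 := by
  simp [wN]

lemma wN_sum_le {ι : Type*} (s : Finset ι) (w : (σ →₀ ℕ) → ℝ≥0∞) (Y : ι → MvPowerSeries σ ℝ) :
    wN w (∑ i ∈ s, Y i) ≤ ∑ i ∈ s, wN w (Y i) := by
  classical
  induction s using Finset.induction_on with
  | empty => simp [wN_zero]
  | insert a s ha ih =>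
    rw [Finset.sum_insert ha, Finset.sum_insert ha]
    exact (wN_add_le _ _ _).trans (by gcongr)

lemma wN_C_mul (w : (σ →₀ ℕ) → ℝ≥0∞) (c : ℝ) (Y : MvPowerSeries σ ℝ) :
    wN w (MvPowerSeries.C c * Y) = ‖c‖ₑ * wN w Y := by
  simp only [wN, MvPowerSeries.coeff_C_mul, enorm_mul, mul_assoc, ENNReal.tsum_mul_left]

lemma wN_one_le (w : (σ →₀ ℕ) → ℝ≥0∞) : wN w (1 : MvPowerSeries σ ℝ) ≤ w 0 := by
  classical
  unfold wN
  rw [tsum_eq_single 0]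
  · simp
  · intro m hm; simp [MvPowerSeries.coeff_one, hm]

lemma coeff_add_X_mul (s : σ) (m : σ →₀ ℕ) (Y : MvPowerSeries σ ℝ) :
    MvPowerSeries.coeff (m + Finsupp.single s 1) (MvPowerSeries.X s * Y)
      = MvPowerSeries.coeff m Y := by
  have := MvPowerSeries.coeff_add_monomial_mul (Finsupp.single s 1) m Y (1 : ℝ)
  rw [add_comm, MvPowerSeries.X, this, one_mul]

lemma coeff_X_mul_of_zero (s : σ) (m : σ →₀ ℕ) (hm : m s = 0) (Y : MvPowerSeries σ ℝ) :
    MvPowerSeries.coeff m (MvPowerSeries.X s * Y) = 0 := by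
  classical
  rw [MvPowerSeries.X, MvPowerSeries.coeff_monomial_mul, if_neg]
  intro h
  have := h s
  simp [hm] at this

lemma exists_add_single (s : σ) (m : σ →₀ ℕ) (hm : m s ≠ 0) :
    ∃ m', m = m' + Finsupp.single s 1 := by
  refine ⟨m - Finsupp.single s 1, ?_⟩
  rw [tsub_add_cancel_of_le]
  simpa using Nat.one_le_iff_ne_zero.2 hm

lemma support_X_mul (s : σ) {α : Type*} [Zero α] (F : (σ →₀ ℕ) → α)
    (hF : ∀ m, m s = 0 → F m = 0) :
    Function.support F ⊆ Set.range (fun m : σ →₀ ℕ => m + Finsupp.single s 1) := by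
  intro m hm
  obtain ⟨m', rfl⟩ := exists_add_single s m (fun h => hm (hF m h))
  exact ⟨m', rfl⟩

lemma wN_X_mul (w : (σ →₀ ℕ) → ℝ≥0∞) (s : σ) (Y : MvPowerSeries σ ℝ) :
    wN w (MvPowerSeries.X s * Y) = wN (fun m => w (m + Finsupp.single s 1)) Y := by
  unfold wN
  rw [← Function.Injective.tsum_eq (g := fun m : σ →₀ ℕ => m + Finsupp.single s 1)
    (add_left_injective _)]
  · simp only [coeff_add_X_mul]
  · exact support_X_mul s _ (fun m hm => by simp [coeff_X_mul_of_zero s m hm])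

/-- geometric weight -/
noncomputable def gw (ρ : ℝ≥0∞) (m : σ →₀ ℕ) : ℝ≥0∞ := ρ ^ m.degree

lemma gw_add (ρ : ℝ≥0∞) (m k : σ →₀ ℕ) : gw ρ (m + k) = gw ρ m * gw ρ k := by
  simp [gw, map_add, pow_add]

lemma gw_single (ρ : ℝ≥0∞) (s : σ) : gw ρ (Finsupp.single s 1) = ρ := by
  simp [gw]

lemma wN_X_mul_gw (ρ : ℝ≥0∞) (s : σ) (Y : MvPowerSeries σ ℝ) :
    wN (gw ρ) (MvPowerSeries.X s * Y) = ρ * wN (gw ρ) Y := by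
  rw [wN_X_mul]
  simp only [wN, gw_add, gw_single]
  rw [← ENNReal.tsum_mul_left]
  congr 1; ext m; ring

lemma wN_mul_le (ρ : ℝ≥0∞) (Y Z : MvPowerSeries σ ℝ) :
    wN (gw ρ) (Y * Z) ≤ wN (gw ρ) Y * wN (gw ρ) Z := by
  classical
  have h1 : wN (gw ρ) Y * wN (gw ρ) Z = ∑' p : (σ →₀ ℕ) × (σ →₀ ℕ),
      (‖MvPowerSeries.coeff p.1 Y‖ₑ * gw ρ p.1) * (‖MvPowerSeries.coeff p.2 Z‖ₑ * gw ρ p.2) := by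
    rw [ENNReal.tsum_prod']
    simp only [wN, ENNReal.tsum_mul_left, ENNReal.tsum_mul_right]
  rw [h1, ← Finset.HasAntidiagonal.sigmaAntidiagonalEquivProd.tsum_eq, ENNReal.tsum_sigma']
  unfold wN
  refine ENNReal.tsum_le_tsum fun m => ?_
  rw [tsum_fintype, MvPowerSeries.coeff_mul]
  have : ∑ b : Finset.HasAntidiagonal.antidiagonal m,
      (‖MvPowerSeries.coeff (Finset.HasAntidiagonal.sigmaAntidiagonalEquivProd ⟨m, b⟩).1 Y‖ₑ *
        gw ρ (Finset.HasAntidiagonal.sigmaAntidiagonalEquivProd ⟨m, b⟩).1) *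
      (‖MvPowerSeries.coeff (Finset.HasAntidiagonal.sigmaAntidiagonalEquivProd ⟨m, b⟩).2 Z‖ₑ *
        gw ρ (Finset.HasAntidiagonal.sigmaAntidiagonalEquivProd ⟨m, b⟩).2) =
      ∑ p ∈ Finset.HasAntidiagonal.antidiagonal m, (‖MvPowerSeries.coeff p.1 Y‖ₑ * gw ρ p.1) *
        (‖MvPowerSeries.coeff p.2 Z‖ₑ * gw ρ p.2) :=
    Finset.sum_coe_sort (Finset.HasAntidiagonal.antidiagonal m) (fun p => (‖MvPowerSeries.coeff p.1 Y‖ₑ * gw ρ p.1) *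
        (‖MvPowerSeries.coeff p.2 Z‖ₑ * gw ρ p.2))
  rw [this]
  calc _ ≤ (∑ p ∈ Finset.HasAntidiagonal.antidiagonal m, ‖MvPowerSeries.coeff p.1 Y * MvPowerSeries.coeff p.2 Z‖ₑ)
        * gw ρ m := by
        gcongr; exact enorm_sum_le _ _
    _ = _ := by
        rw [Finset.sum_mul]
        refine Finset.sum_congr rfl fun p hp => ?_
        rw [← Finset.HasAntidiagonal.mem_antidiagonal.1 hp, gw_add, enorm_mul]; ring

/-- nonnegative coefficients -/
def NN (Y : MvPowerSeries σ ℝ) : Prop := ∀ m, 0 ≤ MvPowerSeries.coeff m Y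

lemma NN.mul {Y Z : MvPowerSeries σ ℝ} (hY : NN Y) (hZ : NN Z) : NN (Y * Z) := by
  classical
  intro m
  rw [MvPowerSeries.coeff_mul]
  exact Finset.sum_nonneg fun p _ => mul_nonneg (hY _) (hZ _)

lemma NN.sum {ι : Type*} {s : Finset ι} {Y : ι → MvPowerSeries σ ℝ} (h : ∀ i ∈ s, NN (Y i)) :
    NN (∑ i ∈ s, Y i) := by
  intro m
  rw [map_sum]
  exact Finset.sum_nonneg fun i hi => h i hi m

lemma NN_C {c : ℝ} (hc : 0 ≤ c) : NN (MvPowerSeries.C c : MvPowerSeries σ ℝ) := by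
  classical
  intro m
  rw [MvPowerSeries.coeff_C]
  split_ifs <;> simp [hc]

lemma NN_one : NN (1 : MvPowerSeries σ ℝ) := by
  simpa using NN_C (σ := σ) (zero_le_one (α := ℝ))

lemma NN_X (s : σ) : NN (MvPowerSeries.X s : MvPowerSeries σ ℝ) := by
  classical
  intro m
  rw [MvPowerSeries.coeff_X]
  split_ifs <;> simp

end KP

namespace KP

open scoped ENNReal NNReal

variable {σ : Type*} {ι : Type*} [Fintype ι] [DecidableEq ι]

noncomputable def XB (s : ι → σ) (B : Matrix ι ι ℝ) : Matrix ι ι (MvPowerSeries σ ℝ) :=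
  Matrix.of fun i j => MvPowerSeries.X (s i) * MvPowerSeries.C (B i j)

noncomputable def MM (s : ι → σ) (B : Matrix ι ι ℝ) : Matrix ι ι (MvPowerSeries σ ℝ) :=
  1 - XB s B

noncomputable def QQ (s : ι → σ) (B : Matrix ι ι ℝ) : MvPowerSeries σ ℝ :=
  Ring.inverse (MM s B).det

noncomputable def WW (s : ι → σ) (B : Matrix ι ι ℝ) : Matrix ι ι (MvPowerSeries σ ℝ) :=
  (MM s B)⁻¹

lemma constCoeff_det (s : ι → σ) (B : Matrix ι ι ℝ) :
    MvPowerSeries.constantCoeff (MM s B).det = 1 := by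
  rw [RingHom.map_det]
  have : (MvPowerSeries.constantCoeff).mapMatrix (MM s B) = (1 : Matrix ι ι ℝ) := by
    ext i j
    by_cases h : i = j <;> simp [MM, XB, Matrix.one_apply, h]
  rw [this, det_one]

lemma isUnit_det (s : ι → σ) (B : Matrix ι ι ℝ) : IsUnit (MM s B).det := by
  rw [MvPowerSeries.isUnit_iff_constantCoeff, constCoeff_det]
  exact isUnit_one

lemma det_mul_QQ (s : ι → σ) (B : Matrix ι ι ℝ) : (MM s B).det * QQ s B = 1 :=
  Ring.mul_inverse_cancel _ (isUnit_det s B)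

lemma MM_mul_WW (s : ι → σ) (B : Matrix ι ι ℝ) : MM s B * WW s B = 1 :=
  Matrix.mul_nonsing_inv _ (isUnit_det s B)

lemma WW_mul_MM (s : ι → σ) (B : Matrix ι ι ℝ) : WW s B * MM s B = 1 :=
  Matrix.nonsing_inv_mul _ (isUnit_det s B)

lemma WW_eq (s : ι → σ) (B : Matrix ι ι ℝ) : WW s B = 1 + XB s B * WW s B := by
  have h := MM_mul_WW s B
  rw [MM, sub_mul, one_mul] at h
  rw [← h]; abel

lemma WW_apply (s : ι → σ) (B : Matrix ι ι ℝ) (i j : ι) :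
    WW s B i j = (1 : Matrix ι ι (MvPowerSeries σ ℝ)) i j
      + MvPowerSeries.X (s i) * ∑ l, MvPowerSeries.C (B i l) * WW s B l j := by
  conv_lhs => rw [WW_eq]
  simp [Matrix.mul_apply, XB, Finset.mul_sum, mul_assoc]

lemma NN_WW (s : ι → σ) (B : Matrix ι ι ℝ) (hB : ∀ i j, 0 ≤ B i j) (i j : ι) :
    NN (WW s B i j) := by
  suffices h : ∀ N : ℕ, ∀ m : σ →₀ ℕ, m.degree = N → ∀ i j,
      0 ≤ MvPowerSeries.coeff m (WW s B i j) from fun m => h _ m rfl i j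
  intro N
  induction N with
  | zero =>
    intro m hm i j
    rw [WW_apply, map_add, coeff_X_mul_of_zero]
    · rw [add_zero, Matrix.one_apply]
      split_ifs
      · exact NN_one m
      · simp
    · rw [Finsupp.degree_eq_zero_iff] at hm; simp [hm]
  | succ N ih =>
    intro m hm i j
    rw [WW_apply, map_add]
    refine add_nonneg ?_ ?_
    · rw [Matrix.one_apply]
      split_ifs
      · exact NN_one m
      · simp
    · by_cases h0 : m (s i) = 0
      · rw [coeff_X_mul_of_zero _ _ h0]
      · obtain ⟨m', rfl⟩ := exists_add_single _ _ h0
        rw [coeff_add_X_mul, map_sum]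
        refine Finset.sum_nonneg fun l _ => ?_
        rw [MvPowerSeries.coeff_C_mul]
        refine mul_nonneg (hB _ _) (ih m' ?_ l j)
        simpa [map_add] using hm

/-- truncated geometric weight -/
noncomputable def tw (ρ : ℝ≥0∞) (N : ℕ) (m : σ →₀ ℕ) : ℝ≥0∞ :=
  if m.degree ≤ N then gw ρ m else 0

lemma wN_tw_WW (s : ι → σ) (B : Matrix ι ι ℝ) (ρ : ℝ≥0∞) (v : ι → ℝ≥0∞)
    (hv : ∀ i, 1 + ρ * ∑ l, ‖B i l‖ₑ * v l ≤ v i) (N : ℕ) (i : ι) :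
    ∑ j, wN (tw ρ N) (WW s B i j) ≤ v i := by
  have h1 : ∀ N i, ∑ j, wN (tw ρ N) ((1 : Matrix ι ι (MvPowerSeries σ ℝ)) i j) ≤ 1 := by
    intro N i
    rw [Finset.sum_eq_single i]
    · rw [Matrix.one_apply_eq]
      refine (wN_one_le _).trans ?_
      simp [tw, gw]
    · intro j _ hj; rw [Matrix.one_apply_ne hj.symm, wN_zero]
    · simp
  induction N generalizing i with
  | zero =>
    refine le_trans ?_ (le_self_add.trans (hv i))
    refine le_trans ?_ (h1 0 i)
    refine Finset.sum_le_sum fun j _ => ?_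
    rw [WW_apply]
    refine (wN_add_le _ _ _).trans ?_
    rw [wN_X_mul]
    have : (fun m : σ →₀ ℕ => tw ρ 0 (m + Finsupp.single (s i) 1)) = fun _ => 0 := by
      ext m; simp [tw]
    rw [this]
    simp [wN]
  | succ N ih =>
    refine le_trans ?_ (hv i)
    calc ∑ j, wN (tw ρ (N+1)) (WW s B i j)
        ≤ ∑ j, (wN (tw ρ (N+1)) ((1 : Matrix ι ι (MvPowerSeries σ ℝ)) i j)
          + ρ * ∑ l, ‖B i l‖ₑ * wN (tw ρ N) (WW s B l j)) := by
          refine Finset.sum_le_sum fun j _ => ?_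
          conv_lhs => rw [WW_apply]
          refine (wN_add_le _ _ _).trans ?_
          gcongr
          rw [wN_X_mul]
          have : (fun m : σ →₀ ℕ => tw ρ (N+1) (m + Finsupp.single (s i) 1))
              = fun m => ρ * tw ρ N m := by
            ext m; simp [tw, gw, map_add, pow_succ, mul_comm]
          rw [this]
          have h2 : ∀ Y : MvPowerSeries σ ℝ, wN (fun m => ρ * tw ρ N m) Y = ρ * wN (tw ρ N) Y := by
            intro Y
            simp only [wN]
            rw [← ENNReal.tsum_mul_left]
            congr 1; ext m; ring
          rw [h2]
          gcongr
          refine (wN_sum_le _ _ _).trans ?_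
          simp [wN_C_mul]
      _ ≤ _ := by
          rw [Finset.sum_add_distrib, ← Finset.mul_sum, Finset.sum_comm]
          gcongr
          · exact h1 _ _
          · rw [← Finset.mul_sum]
            gcongr
            exact ih _

lemma wN_WW (s : ι → σ) (B : Matrix ι ι ℝ) (ρ : ℝ≥0∞) (v : ι → ℝ≥0∞)
    (hv : ∀ i, 1 + ρ * ∑ l, ‖B i l‖ₑ * v l ≤ v i) (i j : ι) :
    wN (gw ρ) (WW s B i j) ≤ v i := by
  unfold wN
  refine ENNReal.summable.tsum_le_of_sum_le (fun F => ?_)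
  refine le_trans ?_ (wN_tw_WW s B ρ v hv (F.sup fun m => m.degree) i)
  refine le_trans ?_ (Finset.single_le_sum (f := fun j => wN (tw ρ _) (WW s B i j))
    (fun _ _ => zero_le) (Finset.mem_univ j))
  refine le_trans ?_ (ENNReal.sum_le_tsum F)
  refine Finset.sum_le_sum fun m hm => ?_
  gcongr
  rw [tw, if_pos]
  exact Finset.le_sup (f := fun m : σ →₀ ℕ => m.degree) hm

lemma QQ_succ {k : ℕ} (s : Fin (k+1) → σ) (B : Matrix (Fin (k+1)) (Fin (k+1)) ℝ) :
    QQ s B = WW s B 0 0 * QQ (s ∘ Fin.succ) (B.submatrix Fin.succ Fin.succ) := by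
  have h1 : WW s B 0 0 = QQ s B * (MM (s ∘ Fin.succ) (B.submatrix Fin.succ Fin.succ)).det := by
    rw [WW, Matrix.inv_def, Matrix.smul_apply, Matrix.adjugate_fin_succ_eq_det_submatrix]
    simp only [smul_eq_mul, QQ]
    congr 1
    simp only [Fin.val_zero, add_zero, pow_zero, one_mul, Fin.succAbove_zero]
    congr 1
    ext i j : 2
    simp [MM, XB, Matrix.one_apply]
  rw [h1, mul_assoc, det_mul_QQ, mul_one]

lemma QQ_props (ρ K : ℝ≥0∞) : ∀ (k : ℕ) (s : Fin k → σ) (B : Matrix (Fin k) (Fin k) ℝ)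
    (_ : ∀ i j, 0 ≤ B i j) (v : Fin k → ℝ≥0∞)
    (_ : ∀ i, 1 + ρ * ∑ l, ‖B i l‖ₑ * v l ≤ v i) (_ : ∀ i, v i ≤ K),
    NN (QQ s B) ∧ wN (gw ρ) (QQ s B) ≤ K ^ k := by
  intro k
  induction k with
  | zero =>
    intro s B _ v _ _
    have : QQ s B = 1 := by simp [QQ]
    rw [this]
    refine ⟨NN_one, (wN_one_le _).trans ?_⟩
    simp [gw]
  | succ k ih =>
    intro s B hB v hv hvK
    obtain ⟨h1, h2⟩ := ih (s ∘ Fin.succ) (B.submatrix Fin.succ Fin.succ) (fun i j => hB _ _)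
      (v ∘ Fin.succ) (fun i => by
        refine le_trans ?_ (hv i.succ)
        gcongr
        rw [Fin.sum_univ_succ]
        exact le_add_self) (fun i => hvK _)
    rw [QQ_succ]
    refine ⟨(NN_WW s B hB 0 0).mul h1, (wN_mul_le _ _ _).trans ?_⟩
    rw [pow_succ, mul_comm]
    gcongr
    exact (wN_WW s B ρ v hv 0 0).trans (hvK 0)

end KP

namespace KP

open scoped ENNReal NNReal

variable {σ : Type*} {ι : Type*} [Fintype ι] [DecidableEq ι]

/-- coefficientwise derivative of a family of power series -/
def CD (Y : ℝ → MvPowerSeries σ ℝ) (Y' : MvPowerSeries σ ℝ) (S : Set ℝ) (a : ℝ) : Prop :=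
  ∀ m, HasDerivWithinAt (fun t => MvPowerSeries.coeff m (Y t)) (MvPowerSeries.coeff m Y') S a

lemma CD.mul {Y Z : ℝ → MvPowerSeries σ ℝ} {Y' Z' : MvPowerSeries σ ℝ} {S : Set ℝ} {a : ℝ}
    (hY : CD Y Y' S a) (hZ : CD Z Z' S a) :
    CD (fun t => Y t * Z t) (Y' * Z a + Y a * Z') S a := by
  classical
  intro m
  simp only [map_add, MvPowerSeries.coeff_mul, ← Finset.sum_add_distrib]
  exact HasDerivWithinAt.fun_sum fun p _ => (hY p.1).mul (hZ p.2)

lemma CD.sum {κ : Type*} {s : Finset κ} {Y : κ → ℝ → MvPowerSeries σ ℝ}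
    {Y' : κ → MvPowerSeries σ ℝ} {S : Set ℝ} {a : ℝ} (h : ∀ i ∈ s, CD (Y i) (Y' i) S a) :
    CD (fun t => ∑ i ∈ s, Y i t) (∑ i ∈ s, Y' i) S a := by
  intro m
  simp only [map_sum]
  exact HasDerivWithinAt.fun_sum fun p hp => h p hp m

lemma CD_const (Y : MvPowerSeries σ ℝ) (S : Set ℝ) (a : ℝ) : CD (fun _ => Y) 0 S a := by
  intro m
  simpa using hasDerivWithinAt_const a S (MvPowerSeries.coeff m Y)

lemma CD_C {r : ℝ → ℝ} {r' : ℝ} {S : Set ℝ} {a : ℝ} (h : HasDerivWithinAt r r' S a) :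
    CD (σ := σ) (fun t => MvPowerSeries.C (r t)) (MvPowerSeries.C r') S a := by
  classical
  intro m
  simp only [MvPowerSeries.coeff_C]
  split_ifs
  · exact h
  · exact hasDerivWithinAt_const _ _ _

lemma CD.sub {Y Z : ℝ → MvPowerSeries σ ℝ} {Y' Z' : MvPowerSeries σ ℝ} {S : Set ℝ} {a : ℝ}
    (hY : CD Y Y' S a) (hZ : CD Z Z' S a) :
    CD (fun t => Y t - Z t) (Y' - Z') S a := by
  intro m
  simp only [map_sub]
  exact (hY m).sub (hZ m)

lemma CD.const_mul (Y : MvPowerSeries σ ℝ) {Z : ℝ → MvPowerSeries σ ℝ} {Z' : MvPowerSeries σ ℝ}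
    {S : Set ℝ} {a : ℝ} (hZ : CD Z Z' S a) :
    CD (fun t => Y * Z t) (Y * Z') S a := by
  simpa using (CD_const Y S a).mul hZ

lemma CD.prod {κ : Type*} [DecidableEq κ] {s : Finset κ} {Y : κ → ℝ → MvPowerSeries σ ℝ}
    {Y' : κ → MvPowerSeries σ ℝ} {S : Set ℝ} {a : ℝ} (h : ∀ i ∈ s, CD (Y i) (Y' i) S a) :
    CD (fun t => ∏ i ∈ s, Y i t) (∑ i ∈ s, Y' i * ∏ j ∈ s.erase i, Y j a) S a := by
  induction s using Finset.induction_on with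
  | empty => simpa using CD_const 1 S a
  | insert b s hb ih =>
    have h1 := (h b (Finset.mem_insert_self _ _)).mul
      (ih fun i hi => h i (Finset.mem_insert_of_mem hi))
    simp only [Finset.prod_insert hb, Finset.sum_insert hb, Finset.erase_insert hb]
    convert h1 using 2
    rw [Finset.mul_sum]
    refine Finset.sum_congr rfl fun i hi => ?_
    have hne : b ≠ i := fun h => hb (h ▸ hi)
    rw [Finset.erase_insert_of_ne hne, Finset.prod_insert (fun h => hb (Finset.mem_of_mem_erase h))]
    ring

lemma CD_det {M : ℝ → Matrix ι ι (MvPowerSeries σ ℝ)} {M' : Matrix ι ι (MvPowerSeries σ ℝ)}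
    {S : Set ℝ} {a : ℝ} (h : ∀ i j, CD (fun t => M t i j) (M' i j) S a) :
    CD (fun t => (M t).det) ((M a).adjugate * M').trace S a := by
  have h1 : ((M a).adjugate * M').trace = ∑ p : Equiv.Perm ι,
      MvPowerSeries.C (((Equiv.Perm.sign p : ℤˣ) : ℤ) : ℝ) *
        ∑ i, M' (p i) i * ∏ j ∈ Finset.univ.erase i, M a (p j) j := by
    have h2 : ∀ i, ((M a).adjugate * M') i i = ((M a).updateCol i (fun k => M' k i)).det := by
      intro i
      rw [← Matrix.cramer_apply, Matrix.cramer_eq_adjugate_mulVec]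
      rfl
    simp only [Matrix.trace, Matrix.diag, h2, Matrix.det_apply']
    rw [Finset.sum_comm]
    refine Finset.sum_congr rfl fun p _ => ?_
    rw [Finset.mul_sum]
    refine Finset.sum_congr rfl fun i _ => ?_
    congr 1
    · simp
    · rw [← Finset.mul_prod_erase _ _ (Finset.mem_univ i)]
      congr 1
      · simp
      · refine Finset.prod_congr rfl fun j hj => ?_
        rw [Matrix.updateCol_ne (Finset.ne_of_mem_erase hj)]
  rw [h1]
  have h3 : (fun t => (M t).det) = fun t => ∑ p : Equiv.Perm ι,
      MvPowerSeries.C (((Equiv.Perm.sign p : ℤˣ) : ℤ) : ℝ) * ∏ i, M t (p i) i := by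
    ext1 t
    rw [Matrix.det_apply']
    simp
  rw [h3]
  exact CD.sum fun p _ => (CD.prod fun i _ => h (p i) i).const_mul _

lemma CD_inv {P Q : ℝ → MvPowerSeries σ ℝ} {P' : MvPowerSeries σ ℝ} {S : Set ℝ} {a : ℝ}
    (hPQ : ∀ t, P t * Q t = 1) (h0 : ∀ t, MvPowerSeries.constantCoeff (P t) = 1)
    (hP' : MvPowerSeries.constantCoeff P' = 0) (h : CD P P' S a) :
    CD Q (-(Q a * Q a * P')) S a := by
  classical
  suffices H : ∀ N : ℕ, ∀ m : σ →₀ ℕ, m.degree = N →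
      HasDerivWithinAt (fun t => MvPowerSeries.coeff m (Q t))
        (MvPowerSeries.coeff m (-(Q a * Q a * P'))) S a from fun m => H _ m rfl
  intro N
  induction N using Nat.strong_induction_on with
  | _ N ih =>
  intro m hm
  have hmem : ((0 : σ →₀ ℕ), m) ∈ Finset.HasAntidiagonal.antidiagonal m := by
    simp [Finset.HasAntidiagonal.mem_antidiagonal]
  have e1 : ∀ t, MvPowerSeries.coeff m (Q t) = MvPowerSeries.coeff m 1 -
      ∑ p ∈ (Finset.HasAntidiagonal.antidiagonal m).erase (0, m),
        MvPowerSeries.coeff p.1 (P t) * MvPowerSeries.coeff p.2 (Q t) := by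
    intro t
    rw [← hPQ t, MvPowerSeries.coeff_mul, ← Finset.add_sum_erase _ _ hmem]
    simp [h0]
  have e2 : MvPowerSeries.coeff m (-(Q a * Q a * P')) = 0 -
      ∑ p ∈ (Finset.HasAntidiagonal.antidiagonal m).erase (0, m),
        (MvPowerSeries.coeff p.1 P' * MvPowerSeries.coeff p.2 (Q a) +
         MvPowerSeries.coeff p.1 (P a) * MvPowerSeries.coeff p.2 (-(Q a * Q a * P'))) := by
    have e3 : P' * Q a + P a * (-(Q a * Q a * P')) = 0 := by
      linear_combination (-(Q a * P')) * hPQ a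
    have e4 := congrArg (MvPowerSeries.coeff m) e3
    rw [map_add, MvPowerSeries.coeff_mul, MvPowerSeries.coeff_mul, ← Finset.sum_add_distrib,
      ← Finset.add_sum_erase _ _ hmem] at e4
    simp only [MvPowerSeries.coeff_zero_eq_constantCoeff, hP', h0, map_zero] at e4
    linarith
  rw [e2]
  simp_rw [e1]
  refine (hasDerivWithinAt_const _ _ _).sub (HasDerivWithinAt.fun_sum fun p hp => ?_)
  refine (h p.1).mul (ih p.2.degree ?_ p.2 rfl)
  rw [← hm]
  have hs := Finset.HasAntidiagonal.mem_antidiagonal.1 (Finset.mem_of_mem_erase hp)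
  have hd : p.1.degree + p.2.degree = m.degree := by rw [← hs, map_add]
  have : p.1.degree ≠ 0 := by
    intro h
    rw [Finsupp.degree_eq_zero_iff] at h
    apply Finset.ne_of_mem_erase hp
    ext1
    · exact h
    · rw [← hs, h]; simp
  omega

lemma CD_QQ (s : ι → σ) {B : ℝ → Matrix ι ι ℝ} {B' : Matrix ι ι ℝ} {S : Set ℝ} {a : ℝ}
    (h : ∀ i j, HasDerivWithinAt (fun t => B t i j) (B' i j) S a) :
    CD (fun t => QQ s (B t)) (QQ s (B a) * (WW s (B a) * XB s B').trace) S a := by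
  have h1 : ∀ i j, CD (fun t => MM s (B t) i j) ((-XB s B') i j) S a := by
    intro i j
    simp only [MM, XB, Matrix.sub_apply, Matrix.of_apply, Matrix.neg_apply]
    rw [← zero_sub]
    exact (CD_const _ S a).sub ((CD_C (h i j)).const_mul _)
  have h2 := CD_det h1
  have h3 := CD_inv (Q := fun t => QQ s (B t)) (fun t => det_mul_QQ s (B t))
    (fun t => constCoeff_det s (B t)) ?_ h2
  · convert h3 using 1
    rw [WW, Matrix.inv_def]
    simp only [Matrix.mul_neg, Matrix.trace_neg, Matrix.smul_mul, Matrix.trace_smul, smul_eq_mul]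
    rw [← QQ]
    ring
  · simp [Matrix.trace, Matrix.mul_apply, XB]

end KP

namespace KP

open scoped ENNReal NNReal

variable {ι : Type*} [Fintype ι] [DecidableEq ι]

/-- matrix of constants -/
noncomputable def CM (B : Matrix ι ι ℝ) : Matrix ι ι (MvPowerSeries ι ℝ) :=
  (MvPowerSeries.C (σ := ι) (R := ℝ)).mapMatrix B

noncomputable def Xd : Matrix ι ι (MvPowerSeries ι ℝ) := Matrix.diagonal MvPowerSeries.X

lemma XB_eq (B : Matrix ι ι ℝ) : XB id B = Xd * CM B := by
  ext i j : 1
  simp [XB, Xd, CM, Matrix.diagonal_mul]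

noncomputable def TT (B : Matrix ι ι ℝ) : Matrix ι ι (MvPowerSeries ι ℝ) := CM B * WW id B

noncomputable def Psi (B : Matrix ι ι ℝ) : MvPowerSeries ι ℝ :=
  MvPowerSeries.C (1 - B).det * QQ id B

noncomputable def UU (B : Matrix ι ι ℝ) (i j : ι) : MvPowerSeries ι ℝ :=
  Psi B * (-(1 - Xd) + (1 - Xd) * TT B * (1 - Xd) : Matrix ι ι (MvPowerSeries ι ℝ)) j i

lemma CD_Psi {B : ℝ → Matrix ι ι ℝ} {B' G' : Matrix ι ι ℝ} {S : Set ℝ} {a c : ℝ}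
    (h : ∀ i j, HasDerivWithinAt (fun t => B t i j) (B' i j) S a)
    (hB' : B' = c • ((1 - B a) * G' * (1 - B a))) :
    CD (fun t => Psi (B t)) (∑ i, ∑ j, MvPowerSeries.C (c * G' i j) * UU (B a) i j) S a := by
  have h1 : CD (fun t => MvPowerSeries.C (σ := ι) (1 - B t).det)
      ((CM (1 - B a)).adjugate * (-CM B')).trace S a := by
    have : (fun t => MvPowerSeries.C (σ := ι) (1 - B t).det) = fun t => (CM (1 - B t)).det := by
      ext1 t; rw [CM, RingHom.map_det]
    rw [this]
    refine CD_det fun i j => ?_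
    simp only [CM, RingHom.mapMatrix_apply, Matrix.map_apply, Matrix.neg_apply, Matrix.sub_apply]
    rw [← map_neg]
    refine CD_C ?_
    rw [← zero_sub]
    exact (hasDerivWithinAt_const _ _ _).sub (h i j)
  have h2 := h1.mul (CD_QQ id h)
  unfold Psi
  convert h2 using 1
  set k := CM (1 - B a) with hk
  set b := CM (B a) with hb
  set g := CM G' with hg
  set w := WW id (B a) with hw
  set x : Matrix ι ι (MvPowerSeries ι ℝ) := Xd with hx
  set d := MvPowerSeries.C (σ := ι) (1 - B a).det with hd
  set Q := QQ id (B a)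
  have hkb : k = 1 - b := by rw [hk, hb, CM, CM, map_sub, map_one]
  have hB'' : CM B' = (MvPowerSeries.C c : MvPowerSeries ι ℝ) • (k * g * k) := by
    rw [hB']
    have : CM (c • ((1 - B a) * G' * (1 - B a)))
        = (MvPowerSeries.C c : MvPowerSeries ι ℝ) • CM ((1 - B a) * G' * (1 - B a)) := by
      ext i j : 1
      simp only [CM, RingHom.mapMatrix_apply, Matrix.map_apply, Matrix.smul_apply, smul_eq_mul]
      rw [MvPowerSeries.C.map_mul]
    rw [this]
    simp only [CM, map_mul, hk, hg]
  have hXB' : XB id B' = x * CM B' := XB_eq B'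
  have hwx : w = 1 + x * b * w := by
    have := WW_eq id (B a)
    rwa [XB_eq] at this
  have hwm : w * (1 - x * b) = 1 := by
    have := WW_mul_MM id (B a)
    rwa [MM, XB_eq] at this
  have hdk : d = k.det := by rw [hd, hk, CM, RingHom.map_det]
  have hadj : k.adjugate * k = d • 1 := by rw [Matrix.adjugate_mul, hdk]
  -- first trace
  have t1 : (k.adjugate * -CM B').trace = - (MvPowerSeries.C c * (d * (k * g).trace)) := by
    rw [hB'', Matrix.mul_neg, Matrix.trace_neg, Matrix.mul_smul, Matrix.trace_smul,
      ← Matrix.mul_assoc, ← Matrix.mul_assoc, hadj, Matrix.smul_mul, one_mul, Matrix.smul_mul,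
      Matrix.trace_smul, Matrix.trace_mul_comm g k]
    simp only [smul_eq_mul]
  have t2 : k * w * (x * k) = k - (1 - (1 - x) * (b * w)) * (1 - x) := by
    have e1 : x * k = (1 - x * b) - (1 - x) := by rw [hkb]; noncomm_ring
    have e2 : k * w = 1 - (1 - x) * (b * w) := by
      rw [hkb]
      calc (1 - b) * w = w - b * w := by noncomm_ring
        _ = (1 + x * b * w) - b * w := by rw [← hwx]
        _ = _ := by noncomm_ring
    rw [e1, mul_sub, mul_assoc, hwm, mul_one, e2]
  have t3 : (w * XB id B').trace = MvPowerSeries.C c *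
      ((k * g).trace + ((-(1 - x) + (1 - x) * (b * w) * (1 - x)) * g).trace) := by
    rw [hXB', hB'', Matrix.mul_smul, Matrix.mul_smul, Matrix.trace_smul, smul_eq_mul]
    congr 1
    rw [← Matrix.trace_add, ← add_mul,
      show w * (x * (k * g * k)) = (w * (x * k) * g) * k by noncomm_ring,
      Matrix.trace_mul_comm, show k * (w * (x * k) * g) = (k * w * (x * k)) * g by noncomm_ring, t2]
    congr 2
    noncomm_ring
  rw [t1, t3]
  have t4 : ∑ i, ∑ j, MvPowerSeries.C (c * G' i j) * UU (B a) i j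
      = MvPowerSeries.C c * (d * Q * ((-(1 - x) + (1 - x) * (b * w) * (1 - x)) * g).trace) := by
    rw [Finset.sum_comm]
    simp only [Matrix.trace, Matrix.diag, Matrix.mul_apply (N := g), Finset.mul_sum]
    refine Finset.sum_congr rfl fun i _ => Finset.sum_congr rfl fun j _ => ?_
    have e1 : g j i = MvPowerSeries.C (G' j i) := rfl
    have e2 : UU (B a) j i = d * Q * (-(1 - x) + (1 - x) * (b * w) * (1 - x)) i j := rfl
    rw [e1, e2, map_mul]
    ring
  rw [t4]
  ring

lemma rescale_QQ (B : Matrix ι ι ℝ) (r : ι → ℝ) :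
    MvPowerSeries.rescale r (QQ id B) = QQ id (Matrix.diagonal r * B) := by
  have h1 : MvPowerSeries.rescale r (MM id B).det = (MM id (Matrix.diagonal r * B)).det := by
    rw [RingHom.map_det]
    congr 1
    ext i j : 1
    have hX : MvPowerSeries.rescale r (MvPowerSeries.X i : MvPowerSeries ι ℝ)
        = MvPowerSeries.C (r i) * MvPowerSeries.X i := by
      ext m
      rw [MvPowerSeries.coeff_rescale, MvPowerSeries.coeff_C_mul, MvPowerSeries.coeff_X]
      split_ifs with h
      · subst h; simp
      · simp
    have hC : ∀ c : ℝ, MvPowerSeries.rescale r (MvPowerSeries.C c : MvPowerSeries ι ℝ)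
        = MvPowerSeries.C c := by
      intro c
      ext m
      rw [MvPowerSeries.coeff_rescale, MvPowerSeries.coeff_C]
      split_ifs with h
      · subst h; simp
      · simp
    simp only [MM, XB, RingHom.mapMatrix_apply, Matrix.map_apply, Matrix.sub_apply, map_sub,
      Matrix.of_apply, map_mul, id, hX, hC, Matrix.diagonal_mul, Matrix.one_apply]
    split_ifs
    · rw [map_one]; ring
    · rw [map_zero]; ring
  have h2 := congrArg (MvPowerSeries.rescale r) (det_mul_QQ id B)
  rw [map_mul, h1, map_one] at h2
  have h3 := det_mul_QQ id (Matrix.diagonal r * B)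
  calc _ = QQ id (Matrix.diagonal r * B) * ((MM id (Matrix.diagonal r * B)).det *
        MvPowerSeries.rescale r (QQ id B)) := by
        rw [← mul_assoc, mul_comm (QQ id _), h3, one_mul]
    _ = _ := by rw [h2, mul_one]

lemma euler_QQ (B : Matrix ι ι ℝ) (k : ι) (m : ι →₀ ℕ) :
    MvPowerSeries.coeff m (MvPowerSeries.X k * (QQ id B * TT B k k))
      = m k * MvPowerSeries.coeff m (QQ id B) := by
  let r : ℝ → ι → ℝ := fun t => Function.update 1 k t
  have hr1 : r 1 = 1 := by ext i; by_cases h : i = k <;> simp [r, h]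
  have h1 : CD (fun t => QQ id (Matrix.diagonal (r t) * B))
      (QQ id B * (WW id B * XB id (Matrix.diagonal (Pi.single k 1) * B)).trace) Set.univ 1 := by
    have := CD_QQ (id : ι → ι) (B := fun t => Matrix.diagonal (r t) * B)
      (B' := Matrix.diagonal (Pi.single k 1) * B) (S := Set.univ) (a := 1) ?_
    · have h1B : Matrix.diagonal (r 1) * B = B := by rw [hr1]; simp
      simpa only [h1B] using this
    · intro i j
      simp only [Matrix.diagonal_mul]
      refine HasDerivWithinAt.mul_const ?_ _
      by_cases h : i = k
      · subst h; simpa [r] using hasDerivAt_id' (1 : ℝ)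
      · simpa [r, h] using hasDerivWithinAt_const (1 : ℝ) Set.univ (1 : ℝ)
  have h2 : (WW id B * XB id (Matrix.diagonal (Pi.single k 1) * B)).trace
      = MvPowerSeries.X k * TT B k k := by
    simp only [Matrix.trace, Matrix.diag, XB, TT, CM, id, Matrix.diagonal_mul]
    simp only [Matrix.mul_apply, Matrix.of_apply, RingHom.mapMatrix_apply, Matrix.map_apply, Finset.mul_sum]
    refine Finset.sum_congr rfl fun i _ => ?_
    rw [Finset.sum_eq_single k]
    · simp; ring
    · intro j _ hj; simp [hj]
    · simp
  have h3 := h1 m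
  have h4 : HasDerivWithinAt (fun t : ℝ => MvPowerSeries.coeff m (QQ id (Matrix.diagonal (r t) * B)))
      ((m k) * MvPowerSeries.coeff m (QQ id B)) Set.univ 1 := by
    have e : (fun t : ℝ => MvPowerSeries.coeff m (QQ id (Matrix.diagonal (r t) * B)))
        = fun t => t ^ (m k) * MvPowerSeries.coeff m (QQ id B) := by
      ext1 t
      rw [← rescale_QQ, MvPowerSeries.coeff_rescale]
      congr 1
      rw [Finsupp.prod_fintype _ _ (by simp), Finset.prod_eq_single k]
      · simp [r]
      · intro i _ hi; simp [r, hi]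
      · simp
    rw [e]
    refine HasDerivWithinAt.mul_const ?_ _
    simpa using hasDerivAt_pow (m k) (1 : ℝ)
  have h5 := (hasDerivWithinAt_univ.1 h3).unique (hasDerivWithinAt_univ.1 h4)
  rw [← h5, h2]
  congr 1; ring

end KP

namespace KP

open scoped ENNReal NNReal

variable {ι : Type*} [Fintype ι] [DecidableEq ι]

/-- pairing of a power series with a sequence -/
noncomputable def pr (Y : MvPowerSeries ι ℝ) (g : (ι →₀ ℕ) → ℝ) : ℝ :=
  ∑' m, MvPowerSeries.coeff m Y * g m

noncomputable def Df (i : ι) (g : (ι →₀ ℕ) → ℝ) (m : ι →₀ ℕ) : ℝ := g (m + Finsupp.single i 1) - g m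

/-- geometric growth -/
def GB (ρ : ℝ) (g : (ι →₀ ℕ) → ℝ) : Prop := ∃ C, ∀ m, |g m| ≤ C * ρ ^ m.degree

lemma GB.shift {ρ : ℝ} {g : (ι →₀ ℕ) → ℝ} (h : GB ρ g) (i : ι) :
    GB ρ (fun m => g (m + Finsupp.single i 1)) := by
  obtain ⟨C, hC⟩ := h
  refine ⟨C * ρ, fun m => (hC _).trans (le_of_eq ?_)⟩
  simp [map_add, pow_succ]; ring

lemma GB.sub {ρ : ℝ} {g h : (ι →₀ ℕ) → ℝ} (hg : GB ρ g) (hh : GB ρ h) :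
    GB ρ (fun m => g m - h m) := by
  obtain ⟨C, hC⟩ := hg
  obtain ⟨D, hD⟩ := hh
  refine ⟨C + D, fun m => (abs_sub _ _).trans ?_⟩
  rw [add_mul]; exact add_le_add (hC m) (hD m)

lemma GB.df {ρ : ℝ} {g : (ι →₀ ℕ) → ℝ} (h : GB ρ g) (i : ι) : GB ρ (Df i g) :=
  (h.shift i).sub h

lemma GB.neg {ρ : ℝ} {g : (ι →₀ ℕ) → ℝ} (h : GB ρ g) : GB ρ (fun m => - g m) := by
  obtain ⟨C, hC⟩ := h
  exact ⟨C, fun m => by simpa using hC m⟩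

lemma GB.pre {ρ : ℝ} (hρ : 1 ≤ ρ) {g : (ι →₀ ℕ) → ℝ} (h : GB ρ g) (i : ι) :
    GB ρ (fun m => g (m - Finsupp.single i 1)) := by
  obtain ⟨C, hC⟩ := h
  have hC0 : 0 ≤ C := by
    have := (abs_nonneg _).trans (hC 0)
    simpa using this
  refine ⟨C, fun m => (hC _).trans ?_⟩
  gcongr
  · by_cases h0 : m i = 0
    · have : m - Finsupp.single i 1 = m := by
        ext k; by_cases hk : i = k
        · subst hk; simp [h0]
        · simp [hk]
      rw [this]
    · obtain ⟨m', rfl⟩ := exists_add_single _ _ h0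
      simp [map_add]

lemma summable_coeff {ρ : ℝ} (hρ : 0 ≤ ρ) {Y : MvPowerSeries ι ℝ}
    (hY : wN (gw (ENNReal.ofReal ρ)) Y ≠ ∞) :
    Summable fun m => |MvPowerSeries.coeff m Y| * ρ ^ m.degree := by
  have := ENNReal.summable_toReal hY
  refine this.congr fun m => ?_
  simp [gw, hρ]

lemma tsum_coeff {ρ : ℝ} (hρ : 0 ≤ ρ) {Y : MvPowerSeries ι ℝ}
    (hY : wN (gw (ENNReal.ofReal ρ)) Y ≠ ∞) :
    ∑' m, |MvPowerSeries.coeff m Y| * ρ ^ m.degree = (wN (gw (ENNReal.ofReal ρ)) Y).toReal := by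
  unfold wN at *
  rw [ENNReal.tsum_toReal_eq]
  · refine tsum_congr fun m => ?_
    simp [gw, hρ]
  · exact fun m => ENNReal.ne_top_of_tsum_ne_top hY m

lemma summable_pr {ρ : ℝ} (hρ : 0 ≤ ρ) {Y : MvPowerSeries ι ℝ}
    (hY : wN (gw (ENNReal.ofReal ρ)) Y ≠ ∞) {g : (ι →₀ ℕ) → ℝ} (hg : GB ρ g) :
    Summable fun m => MvPowerSeries.coeff m Y * g m := by
  obtain ⟨C, hC⟩ := hg
  refine Summable.of_norm_bounded ((summable_coeff hρ hY).mul_left C) fun m => ?_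
  rw [Real.norm_eq_abs, abs_mul]
  calc _ ≤ |MvPowerSeries.coeff m Y| * (C * ρ ^ m.degree) := by gcongr; exact hC m
    _ = _ := by ring

lemma pr_X_mul (i : ι) (Y : MvPowerSeries ι ℝ) (g : (ι →₀ ℕ) → ℝ) :
    pr (MvPowerSeries.X i * Y) g = pr Y (fun m => g (m + Finsupp.single i 1)) := by
  unfold pr
  rw [← Function.Injective.tsum_eq (g := fun m : ι →₀ ℕ => m + Finsupp.single i 1)
    (add_left_injective _)]
  · simp only [coeff_add_X_mul]
  · exact support_X_mul i _ (fun m hm => by simp [coeff_X_mul_of_zero i m hm])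

lemma pr_one_sub_X {ρ : ℝ} (hρ : 0 ≤ ρ) (i : ι) {Y : MvPowerSeries ι ℝ}
    (hY : wN (gw (ENNReal.ofReal ρ)) Y ≠ ∞) {g : (ι →₀ ℕ) → ℝ} (hg : GB ρ g) :
    pr ((1 - MvPowerSeries.X i) * Y) g = - pr Y (Df i g) := by
  have hXY : wN (gw (ENNReal.ofReal ρ)) (MvPowerSeries.X i * Y) ≠ ∞ := by
    rw [wN_X_mul_gw]; exact ENNReal.mul_ne_top ENNReal.ofReal_ne_top hY
  have h1 : pr ((1 - MvPowerSeries.X i) * Y) g = pr Y g - pr (MvPowerSeries.X i * Y) g := by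
    unfold pr
    rw [← (summable_pr hρ hY hg).tsum_sub (summable_pr hρ hXY hg)]
    refine tsum_congr fun m => ?_
    rw [sub_mul, one_mul, map_sub, sub_mul]
  rw [h1, pr_X_mul]
  unfold pr Df
  rw [← (summable_pr hρ hY hg).tsum_sub (summable_pr hρ hY (hg.shift i)), ← tsum_neg]
  refine tsum_congr fun m => ?_
  ring

lemma UU_apply (B : Matrix ι ι ℝ) (i j : ι) :
    UU B i j = Psi B * (-(if j = i then 1 - MvPowerSeries.X i else 0)
      + (1 - MvPowerSeries.X j) * TT B j i * (1 - MvPowerSeries.X i)) := by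
  have h : (1 - Xd : Matrix ι ι (MvPowerSeries ι ℝ))
      = Matrix.diagonal (fun i => 1 - MvPowerSeries.X i) := by
    rw [Xd, ← Matrix.diagonal_one, Matrix.diagonal_sub]
  unfold UU
  rw [h, Matrix.add_apply, Matrix.mul_diagonal, Matrix.diagonal_mul, Matrix.neg_apply,
    Matrix.diagonal_apply]
  congr 3
  split_ifs with h
  · rw [h]
  · rfl

lemma pr_UU_off_nonneg {ρ : ℝ} (hρ : 0 ≤ ρ) (B : Matrix ι ι ℝ) {i j : ι} (hij : i ≠ j)
    (hΨ : wN (gw (ENNReal.ofReal ρ)) (Psi B) ≠ ∞)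
    (hT : wN (gw (ENNReal.ofReal ρ)) (TT B j i) ≠ ∞) (hΨ0 : NN (Psi B)) (hT0 : NN (TT B j i))
    {g : (ι →₀ ℕ) → ℝ} (hg : GB ρ g) (hpos : ∀ m, 0 ≤ Df j (Df i g) m) :
    0 ≤ pr (UU B i j) g := by
  have hY : wN (gw (ENNReal.ofReal ρ)) (Psi B * TT B j i) ≠ ∞ :=
    ne_top_of_le_ne_top (ENNReal.mul_ne_top hΨ hT) (wN_mul_le _ _ _)
  have hY1 : wN (gw (ENNReal.ofReal ρ)) ((1 - MvPowerSeries.X j) * (Psi B * TT B j i)) ≠ ∞ := by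
    rw [sub_mul, one_mul]
    refine ne_top_of_le_ne_top (ENNReal.add_ne_top.2 ⟨hY, ?_⟩) (wN_sub_le _ _ _)
    rw [wN_X_mul_gw]; exact ENNReal.mul_ne_top ENNReal.ofReal_ne_top hY
  have h1 : UU B i j = (1 - MvPowerSeries.X i) * ((1 - MvPowerSeries.X j) * (Psi B * TT B j i)) := by
    rw [UU_apply, if_neg hij.symm]; ring
  rw [h1, pr_one_sub_X hρ i hY1 hg, pr_one_sub_X hρ j hY (hg.df i), neg_neg]
  exact tsum_nonneg fun m => mul_nonneg (hΨ0.mul hT0 m) (hpos m)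

lemma pr_UU_diag_nonneg {ρ : ℝ} (hρ : 1 ≤ ρ) (B : Matrix ι ι ℝ) (i : ι)
    (hΨ : wN (gw (ENNReal.ofReal ρ)) (Psi B) ≠ ∞)
    (hT : wN (gw (ENNReal.ofReal ρ)) (TT B i i) ≠ ∞) (hΨ0 : NN (Psi B))
    {g : (ι →₀ ℕ) → ℝ} (hg : GB ρ g)
    (hpos : ∀ m : ι →₀ ℕ, 0 ≤ Df i g m + m i * (Df i g m - Df i g (m - Finsupp.single i 1))) :
    0 ≤ pr (UU B i i) g := by
  have hρ0 : 0 ≤ ρ := by linarith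
  have hY : wN (gw (ENNReal.ofReal ρ)) (Psi B * TT B i i) ≠ ∞ :=
    ne_top_of_le_ne_top (ENNReal.mul_ne_top hΨ hT) (wN_mul_le _ _ _)
  have hXY : wN (gw (ENNReal.ofReal ρ)) (MvPowerSeries.X i * (Psi B * TT B i i)) ≠ ∞ := by
    rw [wN_X_mul_gw]; exact ENNReal.mul_ne_top ENNReal.ofReal_ne_top hY
  have hY1 : wN (gw (ENNReal.ofReal ρ)) ((1 - MvPowerSeries.X i) * (Psi B * TT B i i)) ≠ ∞ := by
    rw [sub_mul, one_mul]
    exact ne_top_of_le_ne_top (ENNReal.add_ne_top.2 ⟨hY, hXY⟩) (wN_sub_le _ _ _)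
  have hZ : wN (gw (ENNReal.ofReal ρ)) (-Psi B + (1 - MvPowerSeries.X i) * (Psi B * TT B i i)) ≠ ∞ := by
    refine ne_top_of_le_ne_top (ENNReal.add_ne_top.2 ⟨?_, hY1⟩) (wN_add_le _ _ _)
    rwa [wN_neg]
  have h1 : UU B i i = (1 - MvPowerSeries.X i) *
      (-Psi B + (1 - MvPowerSeries.X i) * (Psi B * TT B i i)) := by
    rw [UU_apply, if_pos rfl]; ring
  have hD := hg.df i
  let h : (ι →₀ ℕ) → ℝ := fun m => Df i g m - Df i g (m - Finsupp.single i 1)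
  have hh : GB ρ h := hD.sub (hD.pre hρ i)
  have h2 : pr (-Psi B + (1 - MvPowerSeries.X i) * (Psi B * TT B i i)) (Df i g)
      = - pr (Psi B) (Df i g) + pr ((1 - MvPowerSeries.X i) * (Psi B * TT B i i)) (Df i g) := by
    unfold pr
    rw [← tsum_neg, ← (summable_pr hρ0 hΨ hD).neg.tsum_add (summable_pr hρ0 hY1 hD)]
    refine tsum_congr fun m => ?_
    rw [map_add, map_neg]; ring
  have h3 : Df i (Df i g) = fun m => h (m + Finsupp.single i 1) := by
    ext m; simp [h, Df]
  rw [h1, pr_one_sub_X hρ0 i hZ hg, h2, pr_one_sub_X hρ0 i hY hD, h3, ← pr_X_mul]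
  have h4 : pr (Psi B) (Df i g) + pr (MvPowerSeries.X i * (Psi B * TT B i i)) h
      = ∑' m, MvPowerSeries.coeff m (Psi B) * (Df i g m + m i * h m) := by
    unfold pr
    rw [← (summable_pr hρ0 hΨ hD).tsum_add (summable_pr hρ0 hXY hh)]
    refine tsum_congr fun m => ?_
    have : MvPowerSeries.coeff m (MvPowerSeries.X i * (Psi B * TT B i i))
        = m i * MvPowerSeries.coeff m (Psi B) := by
      rw [Psi, mul_assoc, mul_left_comm, MvPowerSeries.coeff_C_mul, euler_QQ,
        MvPowerSeries.coeff_C_mul]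
      ring
    rw [this]; ring
  have h5 : 0 ≤ ∑' m, MvPowerSeries.coeff m (Psi B) * (Df i g m + m i * h m) :=
    tsum_nonneg fun m => mul_nonneg (hΨ0 m) (hpos m)
  rw [← h4] at h5
  linarith

/-- box of multi-indices -/
noncomputable def SN (N : ℕ) : Finset (ι →₀ ℕ) :=
  Finset.Iic (Finsupp.equivFunOnFinite.symm fun _ => N)

lemma lt_degree_of_notMem {N : ℕ} {m : ι →₀ ℕ} (h : m ∉ SN N) : N < m.degree := by
  simp only [SN, Finset.mem_Iic] at h
  have : ∃ i, N < m i := by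
    by_contra! hc
    exact h fun i => by simpa using hc i
  obtain ⟨i, hi⟩ := this
  exact hi.trans_le (Finsupp.le_degree i m)

lemma tendsto_SN : Tendsto (SN : ℕ → Finset (ι →₀ ℕ)) atTop atTop := by
  refine tendsto_atTop_finset_of_monotone ?_ ?_
  · intro a b hab
    refine Finset.Iic_subset_Iic.2 fun i => ?_
    simpa using hab
  · intro m
    refine ⟨m.degree, ?_⟩
    simp only [SN, Finset.mem_Iic]
    intro i
    simpa using Finsupp.le_degree i m

lemma pr_tail {ρ ρ' C : ℝ} (hρ : 0 < ρ) (hρ' : ρ < ρ') {Y : MvPowerSeries ι ℝ} {E : ℝ≥0∞}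
    (hE : E ≠ ∞)
    (hY : wN (gw (ENNReal.ofReal ρ')) Y ≤ E) {g : (ι →₀ ℕ) → ℝ}
    (hg : ∀ m, |g m| ≤ C * ρ ^ m.degree) (N : ℕ) :
    |pr Y g - ∑ m ∈ SN N, MvPowerSeries.coeff m Y * g m| ≤ C * (ρ / ρ') ^ N * E.toReal := by
  have hρ'0 : 0 < ρ' := hρ.trans hρ'
  have hC0 : 0 ≤ C := by
    have := (abs_nonneg _).trans (hg 0)
    simpa using this
  have hY' := ne_top_of_le_ne_top hE hY
  have hg' : GB ρ' g := ⟨C, fun m => (hg m).trans (by gcongr)⟩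
  have hs := summable_pr hρ'0.le hY' hg'
  have hsc := summable_coeff hρ'0.le hY'
  have h1 : pr Y g - ∑ m ∈ SN N, MvPowerSeries.coeff m Y * g m
      = ∑' m, (if m ∈ SN N then 0 else MvPowerSeries.coeff m Y * g m) := by
    have e : ∑ m ∈ SN N, MvPowerSeries.coeff m Y * g m
        = ∑' m, (if m ∈ SN N then MvPowerSeries.coeff m Y * g m else 0) := by
      rw [tsum_eq_sum (s := SN N)]
      · exact Finset.sum_congr rfl fun m hm => by rw [if_pos hm]
      · intro m hm; rw [if_neg hm]
    have hfin : Summable fun m => (if m ∈ SN N then MvPowerSeries.coeff m Y * g m else 0) :=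
      summable_of_ne_finset_zero (s := SN N) fun m hm => by rw [if_neg hm]
    rw [e, pr, ← hs.tsum_sub hfin]
    refine tsum_congr fun m => ?_
    split_ifs <;> simp
  rw [h1]
  have hb : ∀ m, ‖(if m ∈ SN N then 0 else MvPowerSeries.coeff m Y * g m)‖
      ≤ C * (ρ / ρ') ^ N * (|MvPowerSeries.coeff m Y| * ρ' ^ m.degree) := by
    intro m
    split_ifs with hm
    · rw [norm_zero]; positivity
    · rw [Real.norm_eq_abs, abs_mul]
      have e1 : ρ ^ m.degree = (ρ / ρ') ^ m.degree * ρ' ^ m.degree := by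
        rw [← mul_pow, div_mul_cancel₀ _ hρ'0.ne']
      have e2 : (ρ / ρ') ^ m.degree ≤ (ρ / ρ') ^ N :=
        pow_le_pow_of_le_one (by positivity) ((div_le_one hρ'0).2 hρ'.le) (lt_degree_of_notMem hm).le
      calc _ ≤ |MvPowerSeries.coeff m Y| * (C * ρ ^ m.degree) := by gcongr; exact hg m
        _ = |MvPowerSeries.coeff m Y| * (C * ((ρ / ρ') ^ m.degree * ρ' ^ m.degree)) := by rw [e1]
        _ ≤ |MvPowerSeries.coeff m Y| * (C * ((ρ / ρ') ^ N * ρ' ^ m.degree)) := by gcongr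
        _ = _ := by ring
  have h2 := tsum_of_norm_bounded (hsc.mul_left (C * (ρ / ρ') ^ N)).hasSum hb
  rw [Real.norm_eq_abs, tsum_mul_left, tsum_coeff hρ'0.le hY'] at h2
  refine h2.trans ?_
  gcongr

lemma wN_TT_le {ρ K β : ℝ≥0∞} (B : Matrix ι ι ℝ)
    (hW : ∀ i j, wN (gw ρ) (WW id B i j) ≤ K) (hβ : ∀ i j, ‖B i j‖ₑ ≤ β) (i j : ι) :
    wN (gw ρ) (TT B i j) ≤ Fintype.card ι * (β * K) := by
  rw [TT, Matrix.mul_apply]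
  refine (wN_sum_le _ _ _).trans ?_
  calc _ ≤ ∑ l : ι, β * K := by
        refine Finset.sum_le_sum fun l _ => ?_
        simp only [CM, RingHom.mapMatrix_apply, Matrix.map_apply]
        rw [wN_C_mul]
        gcongr
        · exact hβ _ _
        · exact hW _ _
    _ = _ := by simp

lemma NN_TT (B : Matrix ι ι ℝ) (hB : ∀ i j, 0 ≤ B i j) (i j : ι) : NN (TT B i j) := by
  rw [TT, Matrix.mul_apply]
  refine NN.sum fun l _ => ?_
  simp only [CM, RingHom.mapMatrix_apply, Matrix.map_apply]
  exact (NN_C (hB _ _)).mul (NN_WW id B hB _ _)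

lemma wN_one_sub_X (ρ : ℝ≥0∞) (i : ι) :
    wN (gw ρ) (1 - MvPowerSeries.X i : MvPowerSeries ι ℝ) ≤ 1 + ρ := by
  have h1 : wN (gw ρ) (1 : MvPowerSeries ι ℝ) ≤ 1 := (wN_one_le _).trans (by simp [gw])
  refine (wN_sub_le _ _ _).trans ?_
  gcongr
  rw [← mul_one (MvPowerSeries.X i), wN_X_mul_gw]
  exact mul_le_of_le_one_right' h1

lemma wN_UU_le {ρ P T : ℝ≥0∞} (B : Matrix ι ι ℝ) (hP : wN (gw ρ) (Psi B) ≤ P)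
    (hT : ∀ i j, wN (gw ρ) (TT B i j) ≤ T) (i j : ι) :
    wN (gw ρ) (UU B i j) ≤ P * ((1 + ρ) + (1 + ρ) * T * (1 + ρ)) := by
  rw [UU_apply]
  refine (wN_mul_le _ _ _).trans ?_
  gcongr
  refine (wN_add_le _ _ _).trans ?_
  gcongr
  · rw [wN_neg]
    split_ifs
    · exact wN_one_sub_X _ _
    · rw [wN_zero]; exact zero_le
  · refine (wN_mul_le _ _ _).trans ?_
    gcongr
    · refine (wN_mul_le _ _ _).trans ?_
      gcongr
      · exact wN_one_sub_X _ _
      · exact hT _ _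
    · exact wN_one_sub_X _ _

end KP

namespace KP

open scoped ENNReal NNReal

variable {ι : Type*} [Fintype ι] [DecidableEq ι]

/-- monomial evaluation -/
noncomputable def mon (x : ι → ℝ) (m : ι →₀ ℕ) : ℝ := ∏ i, x i ^ m i

lemma mon_add (x : ι → ℝ) (m k : ι →₀ ℕ) : mon x (m + k) = mon x m * mon x k := by
  simp [mon, pow_add, Finset.prod_mul_distrib]

lemma mon_zero (x : ι → ℝ) : mon x 0 = 1 := by simp [mon]

lemma mon_single (x : ι → ℝ) (i : ι) : mon x (Finsupp.single i 1) = x i := by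
  unfold mon
  rw [Finset.prod_eq_single i]
  · simp
  · intro j _ hj; simp [Finsupp.single_apply, hj.symm]
  · simp

lemma mon_nonneg {x : ι → ℝ} (hx : ∀ i, 0 ≤ x i) (m : ι →₀ ℕ) : 0 ≤ mon x m :=
  Finset.prod_nonneg fun i _ => pow_nonneg (hx i) _

lemma mon_le_one {x : ι → ℝ} (hx : ∀ i, 0 ≤ x i) (hx1 : ∀ i, x i ≤ 1) (m : ι →₀ ℕ) :
    mon x m ≤ 1 :=
  Finset.prod_le_one (fun i _ => pow_nonneg (hx i) _) fun i _ => pow_le_one₀ (hx i) (hx1 i)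

noncomputable def ev (x : ι → ℝ) (Y : MvPowerSeries ι ℝ) : ℝ := pr Y (mon x)

lemma summable_ev {x : ι → ℝ} (hx : ∀ i, 0 ≤ x i) (hx1 : ∀ i, x i ≤ 1) {Y : MvPowerSeries ι ℝ}
    (hY : wN (gw 1) Y ≠ ∞) : Summable fun m => ‖MvPowerSeries.coeff m Y * mon x m‖ := by
  have h := summable_coeff (ρ := 1) zero_le_one (Y := Y) (by simpa using hY)
  refine Summable.of_nonneg_of_le (fun _ => norm_nonneg _) (fun m => ?_) h
  rw [norm_mul, Real.norm_eq_abs, Real.norm_eq_abs, one_pow, abs_of_nonneg (mon_nonneg hx m)]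
  gcongr
  exact mon_le_one hx hx1 m

lemma ev_mul {x : ι → ℝ} (hx : ∀ i, 0 ≤ x i) (hx1 : ∀ i, x i ≤ 1) {Y Z : MvPowerSeries ι ℝ}
    (hY : wN (gw 1) Y ≠ ∞) (hZ : wN (gw 1) Z ≠ ∞) : ev x (Y * Z) = ev x Y * ev x Z := by
  have h1 := summable_ev hx hx1 hY
  have h2 := summable_ev hx hx1 hZ
  unfold ev pr
  rw [h1.of_norm.tsum_mul_tsum_eq_tsum_sum_antidiagonal h2.of_norm
    (summable_mul_of_summable_norm h1 h2)]
  refine tsum_congr fun m => ?_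
  rw [MvPowerSeries.coeff_mul, Finset.sum_mul]
  refine Finset.sum_congr rfl fun p hp => ?_
  rw [← Finset.HasAntidiagonal.mem_antidiagonal.1 hp, mon_add]
  ring

lemma ev_add {x : ι → ℝ} (hx : ∀ i, 0 ≤ x i) (hx1 : ∀ i, x i ≤ 1) {Y Z : MvPowerSeries ι ℝ}
    (hY : wN (gw 1) Y ≠ ∞) (hZ : wN (gw 1) Z ≠ ∞) : ev x (Y + Z) = ev x Y + ev x Z := by
  have h1 := (summable_ev hx hx1 hY).of_norm
  have h2 := (summable_ev hx hx1 hZ).of_norm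
  unfold ev pr
  rw [← h1.tsum_add h2]
  refine tsum_congr fun m => ?_
  rw [map_add, add_mul]

lemma ev_C (x : ι → ℝ) (b : ℝ) : ev x (MvPowerSeries.C b) = b := by
  unfold ev pr
  rw [tsum_eq_single 0]
  · simp [mon_zero]
  · intro m hm; rw [MvPowerSeries.coeff_C, if_neg hm, zero_mul]

lemma ev_X (x : ι → ℝ) (i : ι) : ev x (MvPowerSeries.X i) = x i := by
  unfold ev
  rw [← mul_one (MvPowerSeries.X i), pr_X_mul]
  unfold pr
  rw [tsum_eq_single 0]
  · simp [mon_single]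
  · intro m hm; rw [MvPowerSeries.coeff_one, if_neg hm, zero_mul]

lemma wN_C_ne (b : ℝ) : wN (gw 1) (MvPowerSeries.C b : MvPowerSeries ι ℝ) ≠ ∞ := by
  rw [← mul_one (MvPowerSeries.C b), wN_C_mul]
  refine ENNReal.mul_ne_top (by simp) (ne_top_of_le_ne_top ENNReal.one_ne_top
    ((wN_one_le _).trans (by simp [gw])))

/-- absolutely summable series -/
noncomputable def SR (ι : Type*) [Fintype ι] [DecidableEq ι] : Subring (MvPowerSeries ι ℝ) where
  carrier := {Y | wN (gw 1) Y ≠ ∞}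
  mul_mem' := fun ha hb => ne_top_of_le_ne_top (ENNReal.mul_ne_top ha hb) (wN_mul_le _ _ _)
  one_mem' := by
    have := wN_C_ne (ι := ι) 1
    simpa using this
  add_mem' := fun ha hb => ne_top_of_le_ne_top (ENNReal.add_ne_top.2 ⟨ha, hb⟩) (wN_add_le _ _ _)
  zero_mem' := by simp [wN_zero]
  neg_mem' := fun ha => by simpa [wN_neg] using ha

noncomputable def evH {x : ι → ℝ} (hx : ∀ i, 0 ≤ x i) (hx1 : ∀ i, x i ≤ 1) : SR ι →+* ℝ where
  toFun := fun Y => ev x Y.1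
  map_one' := by
    have := ev_C x 1
    simpa using this
  map_mul' := fun Y Z => ev_mul hx hx1 Y.2 Z.2
  map_zero' := by simp [ev, pr]
  map_add' := fun Y Z => ev_add hx hx1 Y.2 Z.2

lemma X_mem (i : ι) : (MvPowerSeries.X i : MvPowerSeries ι ℝ) ∈ SR ι := by
  show wN (gw 1) _ ≠ ∞
  rw [← mul_one (MvPowerSeries.X i), wN_X_mul_gw, one_mul]
  exact (SR ι).one_mem

lemma ev_det_mul_QQ {x : ι → ℝ} (hx : ∀ i, 0 ≤ x i) (hx1 : ∀ i, x i ≤ 1) (B : Matrix ι ι ℝ)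
    (hQ : wN (gw 1) (QQ id B) ≠ ∞) :
    (1 - Matrix.diagonal x * B).det * ev x (QQ id B) = 1 := by
  let M : Matrix ι ι (SR ι) := 1 - Matrix.diagonal (fun i => ⟨_, X_mem i⟩) *
    Matrix.of (fun i j => ⟨_, wN_C_ne (B i j)⟩)
  have h1 : (SR ι).subtype.mapMatrix M = MM id B := by
    rw [map_sub, map_mul, map_one, MM, XB_eq]
    congr 2
    simp only [Xd, RingHom.mapMatrix_apply]
    rw [Matrix.diagonal_map (map_zero _)]
    rfl
  have h2 : (evH hx hx1).mapMatrix M = 1 - Matrix.diagonal x * B := by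
    rw [map_sub, map_mul, map_one]
    congr 2
    · simp only [RingHom.mapMatrix_apply]
      rw [Matrix.diagonal_map (map_zero _)]
      congr 1; ext i; exact ev_X x i
    · ext i j; exact ev_C x _
  have h3 : M.det * ⟨QQ id B, hQ⟩ = 1 := by
    apply Subtype.ext
    have := det_mul_QQ id B
    rw [← h1, ← RingHom.map_det] at this
    exact this
  have h4 := congrArg (evH hx hx1) h3
  rw [map_mul, map_one, RingHom.map_det, h2] at h4
  exact h4

lemma ev_nonneg {x : ι → ℝ} (hx : ∀ i, 0 ≤ x i) {Y : MvPowerSeries ι ℝ} (hY : NN Y) :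
    0 ≤ ev x Y := tsum_nonneg fun m => mul_nonneg (hY m) (mon_nonneg hx m)

lemma det_pos (B : Matrix ι ι ℝ) (hQ : wN (gw 1) (QQ id B) ≠ ∞) (hN : NN (QQ id B)) :
    0 < (1 - B).det := by
  have h := ev_det_mul_QQ (x := fun _ => 1) (fun _ => zero_le_one) (fun _ => le_rfl) B hQ
  have h0 := ev_nonneg (x := fun _ => 1) (fun _ => zero_le_one) hN
  rw [Matrix.diagonal_one, one_mul] at h
  by_contra! hc
  nlinarith

lemma NN_Psi (B : Matrix ι ι ℝ) (hQ : wN (gw 1) (QQ id B) ≠ ∞) (hN : NN (QQ id B)) :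
    NN (Psi B) := (NN_C (det_pos B hQ hN).le).mul hN

lemma ev_Psi {x : ι → ℝ} (hx : ∀ i, 0 ≤ x i) (hx1 : ∀ i, x i ≤ 1) (B : Matrix ι ι ℝ)
    (hQ : wN (gw 1) (QQ id B) ≠ ∞) :
    ev x (Psi B) = (1 - B).det * ((1 - Matrix.diagonal x * B).det)⁻¹ := by
  rw [Psi, ev_mul hx hx1 (wN_C_ne _) hQ, ev_C, eq_inv_of_mul_eq_one_right (ev_det_mul_QQ hx hx1 B hQ)]

end KP

namespace KP

open scoped ENNReal NNReal

/-- Gamma density with integer shape `k+1` and rate `d` -/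
noncomputable def gd (d : ℝ) (k : ℕ) (t : ℝ) : ℝ :=
  d ^ (k + 1) / (k.factorial : ℝ) * t ^ k * Real.exp (-(d * t))

noncomputable def gam (d : ℝ) (k : ℕ) : Measure ℝ :=
  (volume.restrict (Set.Ioi 0)).withDensity (fun t => ENNReal.ofReal (gd d k t))

lemma gd_cont (d : ℝ) (k : ℕ) : Continuous (gd d k) := by
  unfold gd; fun_prop

lemma gd_nonneg {d : ℝ} (hd : 0 < d) (k : ℕ) {t : ℝ} (ht : 0 ≤ t) : 0 ≤ gd d k t := by
  unfold gd; positivity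

lemma integral_gam {d : ℝ} (hd : 0 < d) (k : ℕ) (h : ℝ → ℝ) :
    ∫ t, h t ∂(gam d k) = ∫ t in Set.Ioi 0, gd d k t * h t := by
  unfold gam
  rw [integral_withDensity_eq_integral_toReal_smul (gd_cont d k).measurable.ennreal_ofReal
    (by simp)]
  refine setIntegral_congr_fun measurableSet_Ioi fun t ht => ?_
  simp only [smul_eq_mul]
  rw [ENNReal.toReal_ofReal (gd_nonneg hd k (le_of_lt ht))]

lemma integrable_gam {d : ℝ} (hd : 0 < d) (k : ℕ) (h : ℝ → ℝ) :
    Integrable h (gam d k) ↔ IntegrableOn (fun t => gd d k t * h t) (Set.Ioi 0) := by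
  unfold gam
  rw [integrable_withDensity_iff_integrable_smul' (gd_cont d k).measurable.ennreal_ofReal
    (by simp)]
  refine integrableOn_congr_fun (fun t ht => ?_) measurableSet_Ioi
  simp only [smul_eq_mul]
  rw [ENNReal.toReal_ofReal (gd_nonneg hd k (le_of_lt ht))]

lemma integral_exp_gam {d s : ℝ} (hd : 0 < d) (hs : 0 < d + s) (k : ℕ) :
    ∫ t, Real.exp (-(s * t)) ∂(gam d k) = (d / (d + s)) ^ (k + 1) := by
  rw [integral_gam hd]
  have h := Real.integral_rpow_mul_exp_neg_mul_Ioi (a := k + 1) (r := d + s) (by positivity) hs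
  have h2 : ∀ t ∈ Set.Ioi (0 : ℝ), gd d k t * Real.exp (-(s * t))
      = d ^ (k + 1) / (k.factorial : ℝ) * (t ^ ((k + 1 : ℝ) - 1) * Real.exp (-((d + s) * t))) := by
    intro t ht
    rw [add_sub_cancel_right, Real.rpow_natCast, gd]
    rw [show -((d + s) * t) = -(d * t) + -(s * t) by ring, Real.exp_add]
    ring
  rw [setIntegral_congr_fun measurableSet_Ioi h2, integral_const_mul, h, Real.Gamma_nat_eq_factorial,
    show (k + 1 : ℝ) = ((k + 1 : ℕ) : ℝ) by push_cast; ring, Real.rpow_natCast]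
  have : (k.factorial : ℝ) ≠ 0 := by positivity
  field_simp
  rw [← mul_pow, mul_one_div]

lemma integrable_exp_gam {d s : ℝ} (hd : 0 < d) (hs : 0 < d + s) (k : ℕ) :
    Integrable (fun t => Real.exp (-(s * t))) (gam d k) := by
  by_contra hc
  have := integral_exp_gam hd hs k
  rw [integral_undef hc] at this
  have h : 0 < (d / (d + s)) ^ (k + 1) := by positivity
  linarith

lemma isProb_gam {d : ℝ} (hd : 0 < d) (k : ℕ) : IsProbabilityMeasure (gam d k) := by
  have h1 := integral_exp_gam (s := 0) hd (by simpa) k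
  have h2 := integrable_exp_gam (s := 0) hd (by simpa) k
  simp only [zero_mul, neg_zero, Real.exp_zero, add_zero, div_self hd.ne', one_pow] at h1 h2
  have h3 : IsFiniteMeasure (gam d k) := by
    rw [integrable_const_iff] at h2
    simpa using h2
  refine ⟨?_⟩
  rw [integral_const, smul_eq_mul, mul_one, Measure.real] at h1
  rw [← ENNReal.ofReal_toReal (measure_ne_top (gam d k) Set.univ), h1, ENNReal.ofReal_one]

lemma gam_pos (d : ℝ) (k : ℕ) : ∀ᵐ t ∂(gam d k), 0 < t := by
  refine (withDensity_absolutelyContinuous _ _).ae_le ?_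
  exact ae_restrict_mem measurableSet_Ioi

/-- exponential bound on the half line -/
def E1 (δ : ℝ) (h : ℝ → ℝ) : Prop := ∃ C, ∀ t, 0 ≤ t → |h t| ≤ C * Real.exp (δ * t)

lemma E1.integrable {d δ : ℝ} (hd : 0 < d) (hδ : δ < d) {h : ℝ → ℝ} (hE : E1 δ h)
    (hc : Continuous h) (k : ℕ) : Integrable h (gam d k) := by
  obtain ⟨C, hC⟩ := hE
  have := (integrable_exp_gam (s := -δ) hd (by linarith) k).const_mul C
  refine this.mono' hc.measurable.aestronglyMeasurable ?_
  filter_upwards [gam_pos d k] with t ht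
  simpa using hC t ht.le

lemma hasDerivAt_gd (d : ℝ) (k : ℕ) (t : ℝ) :
    HasDerivAt (gd d (k + 1)) (d * (gd d k t - gd d (k + 1) t)) t := by
  have h1 : HasDerivAt (fun t : ℝ => Real.exp (-(d * t))) (Real.exp (-(d * t)) * (-(d * 1))) t :=
    (((hasDerivAt_id t).const_mul d).neg).exp
  have h2 := (((hasDerivAt_pow (k + 1) t).const_mul
    (d ^ (k + 1 + 1) / ((k + 1).factorial : ℝ))).mul h1)
  refine HasDerivAt.congr_deriv (f := gd d (k + 1)) h2 ?_
  unfold gd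
  rw [Nat.factorial_succ]
  have : (k.factorial : ℝ) ≠ 0 := by positivity
  have : (k + 1 : ℝ) ≠ 0 := by positivity
  push_cast
  field_simp
  ring

lemma mul_gd (d : ℝ) (hd : 0 < d) (k : ℕ) (t : ℝ) :
    t * gd d k t = (k + 1) / d * gd d (k + 1) t := by
  unfold gd
  rw [Nat.factorial_succ]
  have : (k.factorial : ℝ) ≠ 0 := by positivity
  have : (k + 1 : ℝ) ≠ 0 := by positivity
  push_cast
  field_simp
  ring

lemma tendsto_gd_mul {d δ : ℝ} (hδ : δ < d) {h : ℝ → ℝ} (hE : E1 δ h) (k : ℕ) (hd : 0 < d) :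
    Tendsto (fun t => gd d k t * h t) atTop (nhds 0) := by
  obtain ⟨C, hC⟩ := hE
  have h1 : Tendsto (fun t : ℝ => t ^ k * Real.exp (-((d - δ) * t))) atTop (nhds 0) := by
    have := tendsto_rpow_mul_exp_neg_mul_atTop_nhds_zero k (d - δ) (by linarith)
    refine this.congr fun t => ?_
    rw [Real.rpow_natCast, neg_mul]
  have h2 := h1.const_mul (C * (d ^ (k + 1) / (k.factorial : ℝ)))
  rw [mul_zero] at h2
  refine squeeze_zero_norm' ?_ h2
  filter_upwards [eventually_ge_atTop 0] with t ht
  rw [norm_mul, Real.norm_eq_abs, Real.norm_eq_abs, abs_of_nonneg (gd_nonneg hd k ht)]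
  calc _ ≤ gd d k t * (C * Real.exp (δ * t)) := by
        gcongr
        · exact gd_nonneg hd k ht
        · exact hC t ht
    _ = _ := by
        unfold gd
        rw [show -((d - δ) * t) = -(d * t) + δ * t by ring, Real.exp_add]
        ring

lemma L1 {d δ : ℝ} (hd : 0 < d) (hδ : δ < d) {h h' : ℝ → ℝ} (hE : E1 δ h) (hE' : E1 δ h')
    (hc : Continuous h') (hder : ∀ t, HasDerivAt h (h' t) t) (k : ℕ) :
    ∫ t, h' t ∂(gam d (k + 1)) = d * (∫ t, h t ∂(gam d (k + 1)) - ∫ t, h t ∂(gam d k)) := by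
  have hch : Continuous h := continuous_iff_continuousAt.2 fun t => (hder t).continuousAt
  have i1 := (integrable_gam hd _ _).1 (hE'.integrable hd hδ hc (k + 1))
  have i2 := (integrable_gam hd _ _).1 (hE.integrable hd hδ hch (k + 1))
  have i3 := (integrable_gam hd _ _).1 (hE.integrable hd hδ hch k)
  have key := integral_Ioi_of_hasDerivAt_of_tendsto' (a := 0) (m := 0)
    (f := fun t => gd d (k + 1) t * h t)
    (f' := fun t => gd d (k + 1) t * h' t + d * (gd d k t * h t - gd d (k + 1) t * h t))
    (fun t _ => by
      refine HasDerivAt.congr_deriv ((hasDerivAt_gd d k t).mul (hder t)) ?_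
      ring) (i1.add ((i3.sub i2).const_mul d)) (tendsto_gd_mul hδ hE (k + 1) hd)
  have z : gd d (k + 1) 0 = 0 := by simp [gd]
  have i4 : IntegrableOn (fun t => d * (gd d k t * h t - gd d (k + 1) t * h t)) (Set.Ioi 0) :=
    (i3.sub i2).const_mul d
  rw [integral_add i1 i4, integral_const_mul, integral_sub i3 i2, z] at key
  rw [integral_gam hd, integral_gam hd, integral_gam hd]
  linarith

lemma integral_mul_gam {d : ℝ} (hd : 0 < d) (k : ℕ) (h : ℝ → ℝ) :
    ∫ t, t * h t ∂(gam d k) = (k + 1) / d * ∫ t, h t ∂(gam d (k + 1)) := by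
  rw [integral_gam hd, integral_gam hd, ← integral_const_mul]
  congr 1
  ext t
  rw [← mul_assoc, ← mul_assoc, mul_comm _ t, mul_gd d hd]

lemma integrable_mul_gam {d : ℝ} (hd : 0 < d) (k : ℕ) {h : ℝ → ℝ}
    (hi : Integrable h (gam d (k + 1))) : Integrable (fun t => t * h t) (gam d k) := by
  rw [integrable_gam hd] at *
  refine (hi.const_mul ((k + 1) / d)).congr (ae_of_all _ fun t => ?_)
  simp only
  rw [← mul_assoc, ← mul_assoc, mul_comm _ t, mul_gd d hd]

lemma L2 {d δ : ℝ} (hd : 0 < d) (hδ : δ < d) {h h' h'' : ℝ → ℝ} (hE : E1 δ h) (hE' : E1 δ h')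
    (hE'' : E1 δ h'') (hc : Continuous h'') (hder : ∀ t, HasDerivAt h (h' t) t)
    (hder' : ∀ t, HasDerivAt h' (h'' t) t) (k : ℕ) :
    ∫ t, (h' t + t * h'' t) ∂(gam d k)
      = d * ((k + 1) * (∫ t, h t ∂(gam d (k + 1)) - ∫ t, h t ∂(gam d k))
          - k * (∫ t, h t ∂(gam d k) - ∫ t, h t ∂(gam d (k - 1)))) := by
  have hch' : Continuous h' := continuous_iff_continuousAt.2 fun t => (hder' t).continuousAt
  rw [integral_add (hE'.integrable hd hδ hch' k)
    (integrable_mul_gam hd k (hE''.integrable hd hδ hc (k + 1))), integral_mul_gam hd,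
    L1 hd hδ hE' hE'' hc hder' k, L1 hd hδ hE hE' hch' hder k]
  rcases k with _ | k
  · simp; field_simp; ring
  · rw [L1 hd hδ hE hE' hch' hder k, Nat.add_sub_cancel]
    push_cast
    field_simp
    ring

end KP

namespace KP

open scoped ENNReal NNReal

variable {ι : Type*} [Fintype ι] [DecidableEq ι]

noncomputable def Gam (d : ℝ) (m : ι →₀ ℕ) : Measure (ι → ℝ) := Measure.pi fun i => gam d (m i)

lemma isProb_Gam {d : ℝ} (hd : 0 < d) (m : ι →₀ ℕ) : IsProbabilityMeasure (Gam d m) := by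
  have := fun k => isProb_gam hd k
  unfold Gam; infer_instance

/-- exponential bound on the orthant -/
def EB (δ : ℝ) (f : (ι → ℝ) → ℝ) : Prop :=
  ∃ C, ∀ l : ι → ℝ, (∀ i, 0 ≤ l i) → |f l| ≤ C * Real.exp (δ * ∑ i, l i)

noncomputable def hat (d : ℝ) (f : (ι → ℝ) → ℝ) (m : ι →₀ ℕ) : ℝ := ∫ l, f l ∂(Gam d m)

lemma Gam_nonneg {d : ℝ} (hd : 0 < d) (m : ι →₀ ℕ) : ∀ᵐ l ∂(Gam d m), ∀ i, 0 ≤ l i := by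
  have := fun k => isProb_gam hd k
  rw [ae_all_iff]
  intro i
  unfold Gam
  have h := (Measure.quasiMeasurePreserving_eval (μ := fun i => gam d (m i)) i).ae (gam_pos d (m i))
  filter_upwards [h] with l hl using le_of_lt hl

lemma integrable_expsum {d : ℝ} (hd : 0 < d) {s : ι → ℝ} (hs : ∀ i, 0 < d + s i) (m : ι →₀ ℕ) :
    Integrable (fun l : ι → ℝ => Real.exp (-(∑ i, s i * l i))) (Gam d m) := by
  have := fun k => isProb_gam hd k
  have h := Integrable.fintype_prod (μ := fun i => gam d (m i))
    (f := fun i t => Real.exp (-(s i * t))) (fun i => integrable_exp_gam hd (hs i) (m i))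
  refine h.congr (ae_of_all _ fun l => ?_)
  simp only
  rw [← Real.exp_sum, Finset.sum_neg_distrib]

lemma integral_expsum {d : ℝ} (hd : 0 < d) {s : ι → ℝ} (hs : ∀ i, 0 < d + s i) (m : ι →₀ ℕ) :
    ∫ l : ι → ℝ, Real.exp (-(∑ i, s i * l i)) ∂(Gam d m) = ∏ i, (d / (d + s i)) ^ (m i + 1) := by
  have := fun k => isProb_gam hd k
  have h := integral_fintype_prod_eq_prod (𝕜 := ℝ) (μ := fun i => gam d (m i))
    (fun i t => Real.exp (-(s i * t)))
  simp_rw [fun i => integral_exp_gam hd (hs i) (m i)] at h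
  rw [← h]
  unfold Gam
  congr 1
  ext l
  rw [← Real.exp_sum, Finset.sum_neg_distrib]

lemma EB.integrable {d δ : ℝ} (hd : 0 < d) (hδ : δ < d) {f : (ι → ℝ) → ℝ} (hE : EB δ f)
    (hc : Continuous f) (m : ι →₀ ℕ) : Integrable f (Gam d m) := by
  obtain ⟨C, hC⟩ := hE
  have := (integrable_expsum (s := fun _ : ι => -δ) hd (fun _ => by linarith) m).const_mul C
  refine this.mono' hc.measurable.aestronglyMeasurable ?_
  filter_upwards [Gam_nonneg hd m] with l hl
  simpa [Finset.mul_sum] using hC l hl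

lemma GB_hat {d δ : ℝ} (hd : 0 < d) (hδ : δ < d) {f : (ι → ℝ) → ℝ} (hE : EB δ f)
    (hc : Continuous f) : GB (d / (d - δ)) (hat d f) := by
  have hi := fun m => hE.integrable hd hδ hc m
  obtain ⟨C, hC⟩ := hE
  refine ⟨C * (d / (d - δ)) ^ Fintype.card ι, fun m => ?_⟩
  have h1 := (integrable_expsum (s := fun _ : ι => -δ) hd (fun _ => by linarith) m).const_mul C
  have h2 := integral_expsum (s := fun _ : ι => -δ) hd (fun _ => by linarith) m
  calc |hat d f m| ≤ ∫ l, |f l| ∂(Gam d m) := abs_integral_le_integral_abs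
    _ ≤ ∫ l, C * Real.exp (-(∑ i, -δ * l i)) ∂(Gam d m) := by
        refine integral_mono_ae (hi m).abs h1 ?_
        filter_upwards [Gam_nonneg hd m] with l hl
        simpa [Finset.mul_sum] using hC l hl
    _ = _ := by
        rw [integral_const_mul, h2, Finset.prod_pow_eq_pow_sum, Finset.sum_add_distrib]
        rw [Finsupp.degree_eq_sum, Finset.sum_const, Finset.card_univ, smul_eq_mul, mul_one, pow_add,
          ← sub_eq_add_neg]
        ring

lemma map_update (ν : ι → Measure ℝ) [∀ i, IsProbabilityMeasure (ν i)] (κ : Measure ℝ)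
    [IsProbabilityMeasure κ] (i : ι) :
    Measure.map (fun p : (ι → ℝ) × ℝ => Function.update p.1 i p.2) ((Measure.pi ν).prod κ)
      = Measure.pi (Function.update ν i κ) := by
  have hp : ∀ j, IsProbabilityMeasure (Function.update ν i κ j) := by
    intro j; by_cases h : j = i
    · subst h; simpa
    · simpa [h] using inferInstanceAs (IsProbabilityMeasure (ν j))
  have hm : Measurable (fun p : (ι → ℝ) × ℝ => Function.update p.1 i p.2) := by
    rw [measurable_pi_iff]
    intro j; by_cases h : j = i
    · subst h; simpa using measurable_snd
    · simp only [Function.update_of_ne h]; fun_prop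
  symm
  refine Measure.pi_eq fun s hs => ?_
  rw [Measure.map_apply hm (MeasurableSet.univ_pi hs)]
  have : (fun p : (ι → ℝ) × ℝ => Function.update p.1 i p.2) ⁻¹' Set.univ.pi s
      = (Set.univ.pi (Function.update s i Set.univ)) ×ˢ s i := by
    ext ⟨y, t⟩
    simp only [Set.mem_preimage, Set.mem_pi, Set.mem_univ, true_imp_iff, Set.mem_prod]
    constructor
    · intro h
      refine ⟨fun j => ?_, by simpa using h i⟩
      by_cases hj : j = i
      · subst hj; simp
      · simpa [hj] using h j
    · rintro ⟨h1, h2⟩ j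
      by_cases hj : j = i
      · subst hj; simpa using h2
      · simpa [hj] using h1 j
  rw [this, Measure.prod_prod, Measure.pi_pi, ← Finset.mul_prod_erase _ _ (Finset.mem_univ i),
    ← Finset.mul_prod_erase _ (fun j => Function.update ν i κ j (s j)) (Finset.mem_univ i)]
  simp only [Function.update_self, measure_univ, one_mul]
  rw [mul_comm]
  congr 1
  refine Finset.prod_congr rfl fun j hj => ?_
  simp [(Finset.mem_erase.1 hj).1]

lemma Gam_update {d : ℝ} (hd : 0 < d) (m : ι →₀ ℕ) (i : ι) (k : ℕ) :
    Measure.map (fun p : (ι → ℝ) × ℝ => Function.update p.1 i p.2) ((Gam d m).prod (gam d k))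
      = Gam d (m.update i k) := by
  have := fun k => isProb_gam hd k
  unfold Gam
  rw [map_update]
  congr 1
  ext1 j
  by_cases h : j = i
  · subst h; simp
  · simp [h]

lemma measurable_upd (i : ι) : Measurable (fun p : (ι → ℝ) × ℝ => Function.update p.1 i p.2) := by
  rw [measurable_pi_iff]
  intro j; by_cases h : j = i
  · subst h; simpa using measurable_snd
  · simp only [Function.update_of_ne h]; fun_prop

lemma hat_update {d : ℝ} (hd : 0 < d) {F : (ι → ℝ) → ℝ} (m : ι →₀ ℕ) (i : ι) (k : ℕ)
    (hF : Integrable F (Gam d (m.update i k))) :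
    hat d F (m.update i k) = ∫ y, ∫ t, F (Function.update y i t) ∂(gam d k) ∂(Gam d m) ∧
    Integrable (fun y => ∫ t, F (Function.update y i t) ∂(gam d k)) (Gam d m) := by
  have := fun k => isProb_gam hd k
  have := isProb_Gam hd m
  rw [← Gam_update hd] at hF
  have h2 := (integrable_map_measure hF.1 (measurable_upd i).aemeasurable).1 hF
  constructor
  · rw [hat, ← Gam_update hd, integral_map (measurable_upd i).aemeasurable hF.1]
    exact integral_prod _ h2
  · exact h2.integral_prod_left

lemma sum_update (y : ι → ℝ) (i : ι) (t : ℝ) :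
    ∑ j, Function.update y i t j = ∑ j, Function.update y i 0 j + t := by
  rw [← Finset.add_sum_erase _ _ (Finset.mem_univ i),
    ← Finset.add_sum_erase _ (Function.update y i 0) (Finset.mem_univ i)]
  simp only [Function.update_self]
  rw [Finset.sum_congr rfl (g := Function.update y i 0)]
  · ring
  · intro j hj; simp [(Finset.mem_erase.1 hj).1]

lemma EB.E1 {δ : ℝ} {f : (ι → ℝ) → ℝ} (hE : EB δ f) {y : ι → ℝ} (hy : ∀ i, 0 ≤ y i) (i : ι) :
    E1 δ (fun t => f (Function.update y i t)) := by
  obtain ⟨C, hC⟩ := hE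
  refine ⟨C * Real.exp (δ * ∑ j, Function.update y i 0 j), fun t ht => ?_⟩
  refine (hC _ fun j => ?_).trans (le_of_eq ?_)
  · by_cases h : j = i
    · subst h; simpa
    · simpa [h] using hy j
  · rw [sum_update, mul_add, Real.exp_add]; ring

lemma upd_succ (m : ι →₀ ℕ) (i : ι) : m + Finsupp.single i 1 = m.update i (m i + 1) := by
  ext j
  by_cases h : j = i
  · subst h; simp
  · simp [h, Finsupp.single_apply, Ne.symm h]

lemma upd_pred (m : ι →₀ ℕ) (i : ι) : m - Finsupp.single i 1 = m.update i (m i - 1) := by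
  ext j
  by_cases h : j = i
  · subst h; simp
  · simp [h, Finsupp.single_apply, Ne.symm h]

lemma upd_self (m : ι →₀ ℕ) (i : ι) : m.update i (m i) = m := by simp

lemma H2 {d δ : ℝ} (hd : 0 < d) (hδ : δ < d) {f f' : (ι → ℝ) → ℝ} (hE : EB δ f) (hE' : EB δ f')
    (hc : Continuous f) (hc' : Continuous f') (i : ι)
    (hder : ∀ y t, HasDerivAt (fun t => f (Function.update y i t)) (f' (Function.update y i t)) t)
    (m : ι →₀ ℕ) :
    hat d f' (m + Finsupp.single i 1) = d * Df i (hat d f) m := by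
  have a1 := hat_update hd m i (m i + 1) (hE'.integrable hd hδ hc' _)
  have a2 := hat_update hd m i (m i + 1) (hE.integrable hd hδ hc _)
  have a3 := hat_update hd m i (m i) (hE.integrable hd hδ hc _)
  rw [upd_self] at a3
  rw [Df, upd_succ, a1.1, a2.1, a3.1, ← integral_sub a2.2 a3.2, ← integral_const_mul]
  refine integral_congr_ae ?_
  filter_upwards [Gam_nonneg hd m] with y hy
  exact L1 hd hδ (hE.E1 hy i) (hE'.E1 hy i)
    (hc'.comp (continuous_const.update i continuous_id)) (hder y) (m i)

lemma EB.add {δ : ℝ} {f g : (ι → ℝ) → ℝ} (hf : EB δ f) (hg : EB δ g) :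
    EB δ (fun l => f l + g l) := by
  obtain ⟨C, hC⟩ := hf
  obtain ⟨D, hD⟩ := hg
  refine ⟨C + D, fun l hl => (abs_add_le _ _).trans ?_⟩
  rw [add_mul]; exact add_le_add (hC l hl) (hD l hl)

lemma EB.mono {δ δ' : ℝ} (h : δ ≤ δ') {f : (ι → ℝ) → ℝ} (hf : EB δ f) : EB δ' f := by
  obtain ⟨C, hC⟩ := hf
  have hC0 : 0 ≤ C := by
    have := (abs_nonneg _).trans (hC 0 (fun _ => le_rfl))
    simpa using this
  refine ⟨C, fun l hl => (hC l hl).trans ?_⟩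
  have := Finset.sum_nonneg fun i (_ : i ∈ Finset.univ) => hl i
  gcongr

lemma EB.coord {δ δ' : ℝ} (h : δ < δ') {f : (ι → ℝ) → ℝ} (hf : EB δ f) (i : ι) :
    EB δ' (fun l => l i * f l) := by
  obtain ⟨C, hC⟩ := hf
  refine ⟨C / (δ' - δ), fun l hl => ?_⟩
  have hp : 0 < δ' - δ := by linarith
  have hC0 := hC l hl
  have h1 : l i ≤ ∑ j, l j := Finset.single_le_sum (fun j _ => hl j) (Finset.mem_univ i)
  have h2 := Real.add_one_le_exp ((δ' - δ) * ∑ j, l j)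
  have h3 : l i ≤ Real.exp ((δ' - δ) * ∑ j, l j) / (δ' - δ) := by
    rw [le_div_iff₀ hp]; nlinarith
  rw [abs_mul, abs_of_nonneg (hl i)]
  calc l i * |f l| ≤ (Real.exp ((δ' - δ) * ∑ j, l j) / (δ' - δ)) * (C * Real.exp (δ * ∑ j, l j)) := by
        gcongr
    _ = C / (δ' - δ) * (Real.exp ((δ' - δ) * ∑ j, l j) * Real.exp (δ * ∑ j, l j)) := by ring
    _ = _ := by rw [← Real.exp_add]; ring_nf

lemma H3 {d δ : ℝ} (hd : 0 < d) (hδ : δ < d) {f f' f'' : (ι → ℝ) → ℝ} (hE : EB δ f)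
    (hE' : EB δ f') (hE'' : EB δ f'')
    (hc : Continuous f) (hc' : Continuous f') (hc'' : Continuous f'') (i : ι)
    (hder : ∀ y t, HasDerivAt (fun t => f (Function.update y i t)) (f' (Function.update y i t)) t)
    (hder' : ∀ y t, HasDerivAt (fun t => f' (Function.update y i t)) (f'' (Function.update y i t)) t)
    (m : ι →₀ ℕ) :
    hat d (fun l => f' l + l i * f'' l) m
      = d * (Df i (hat d f) m + m i * (Df i (hat d f) m - Df i (hat d f) (m - Finsupp.single i 1))) := by
  have hδ2 : δ < (δ + d) / 2 := by linarith
  have hδ3 : (δ + d) / 2 < d := by linarith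
  have hg : EB ((δ + d) / 2) (fun l => f' l + l i * f'' l) := (hE'.mono hδ2.le).add (hE''.coord hδ2 i)
  have hgc : Continuous (fun l : ι → ℝ => f' l + l i * f'' l) := by fun_prop
  have a1 := hat_update hd m i (m i) (hg.integrable hd hδ3 hgc _)
  have a2 := hat_update hd m i (m i + 1) (hE.integrable hd hδ hc _)
  have a3 := hat_update hd m i (m i) (hE.integrable hd hδ hc _)
  have a4 := hat_update hd m i (m i - 1) (hE.integrable hd hδ hc _)
  rw [upd_self] at a1 a3
  have key : hat d (fun l => f' l + l i * f'' l) m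
      = d * ((m i + 1) * (hat d f (m + Finsupp.single i 1) - hat d f m)
        - m i * (hat d f m - hat d f (m - Finsupp.single i 1))) := by
    rw [upd_succ, upd_pred, a1.1, a2.1, a3.1, a4.1, ← integral_sub a2.2 a3.2,
      ← integral_sub a3.2 a4.2, ← integral_const_mul, ← integral_const_mul, ← integral_sub,
      ← integral_const_mul]
    · refine integral_congr_ae ?_
      filter_upwards [Gam_nonneg hd m] with y hy
      have := L2 hd hδ (hE.E1 hy i) (hE'.E1 hy i) (hE''.E1 hy i)
        (hc''.comp (continuous_const.update i continuous_id)) (hder y) (hder' y) (m i)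
      simpa using this
    · exact (a2.2.sub a3.2).const_mul _
    · exact (a3.2.sub a4.2).const_mul _
  rw [key]
  by_cases h0 : m i = 0
  · simp [Df, h0]
  · have : m - Finsupp.single i 1 + Finsupp.single i 1 = m := by
      obtain ⟨m', rfl⟩ := exists_add_single _ _ h0
      simp
    simp only [Df, this]
    ring

end KP

namespace KP

open scoped ENNReal NNReal

variable {ι : Type*} [Fintype ι] [DecidableEq ι]

/-- exponential test function on the orthant -/
noncomputable def ex (s : ι → ℝ≥0) : BoundedContinuousFunction (ι → ℝ≥0) ℝ :=
  BoundedContinuousFunction.ofNormedAddCommGroup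
    (fun l => Real.exp (-(∑ i, (s i : ℝ) * (l i : ℝ)))) (by fun_prop) 1 (fun l => by
      rw [Real.norm_eq_abs, Real.abs_exp, Real.exp_le_one_iff, neg_nonpos]
      positivity)

lemma ex_apply (s l : ι → ℝ≥0) : ex s l = Real.exp (-(∑ i, (s i : ℝ) * (l i : ℝ))) := rfl

/-- the submonoid of exponentials -/
noncomputable def exM (ι : Type*) [Fintype ι] [DecidableEq ι] :
    Submonoid (BoundedContinuousFunction (ι → ℝ≥0) ℝ) where
  carrier := Set.range ex
  one_mem' := ⟨0, by ext l; simp [ex_apply]⟩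
  mul_mem' := by
    rintro _ _ ⟨s, rfl⟩ ⟨t, rfl⟩
    refine ⟨s + t, ?_⟩
    ext l
    rw [BoundedContinuousFunction.mul_apply, ex_apply, ex_apply, ex_apply, ← Real.exp_add]
    congr 1
    simp [add_mul, Finset.sum_add_distrib]
    ring

noncomputable def exA (ι : Type*) [Fintype ι] [DecidableEq ι] :
    StarSubalgebra ℝ (BoundedContinuousFunction (ι → ℝ≥0) ℝ) where
  toSubalgebra := Algebra.adjoin ℝ (exM ι : Set (BoundedContinuousFunction (ι → ℝ≥0) ℝ))
  star_mem' := by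
    intro a ha
    have : star a = a := by ext l; simp
    rw [this]; exact ha

lemma lap_unique {P P' : Measure (ι → ℝ≥0)} [IsFiniteMeasure P] [IsFiniteMeasure P']
    (h : ∀ s : ι → ℝ≥0, ∫ l, ex s l ∂P = ∫ l, ex s l ∂P') : P = P' := by
  refine ext_of_forall_mem_subalgebra_integral_eq_of_polish (𝕜 := ℝ) (A := exA ι) ?_ ?_
  · intro l l' hne
    obtain ⟨i, hi⟩ := Function.ne_iff.1 hne
    let s : ι → ℝ≥0 := Pi.single i 1
    refine ⟨ex s, ⟨_, ⟨ex s, Algebra.subset_adjoin ⟨s, rfl⟩, rfl⟩, rfl⟩, ?_⟩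
    simp only [ex_apply]
    intro hc
    rw [Real.exp_eq_exp, neg_inj] at hc
    have e : ∀ l : ι → ℝ≥0, ∑ j, (s j : ℝ) * (l j : ℝ) = l i := by
      intro l
      rw [Finset.sum_eq_single i]
      · simp [s]
      · intro j _ hj; simp [s, hj]
      · simp
    rw [e, e] at hc
    exact hi (NNReal.coe_injective hc)
  · intro g hg
    have hg' : g ∈ Submodule.span ℝ
        (exM ι : Set (BoundedContinuousFunction (ι → ℝ≥0) ℝ)) := by
      have := Algebra.adjoin_eq_span ℝ (exM ι : Set (BoundedContinuousFunction (ι → ℝ≥0) ℝ))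
      rw [Submonoid.closure_eq] at this
      rw [← this]
      exact hg
    clear hg
    induction hg' using Submodule.span_induction with
    | mem x hx => obtain ⟨s, rfl⟩ := hx; exact h s
    | zero => simp
    | add x y hx hy ihx ihy =>
      simp only [BoundedContinuousFunction.add_apply]
      rw [integral_add (x.integrable P) (y.integrable P), integral_add (x.integrable P') (y.integrable P'),
        ihx, ihy]
    | smul a x hx ih =>
      simp only [BoundedContinuousFunction.smul_apply, smul_eq_mul]
      rw [integral_const_mul, integral_const_mul, ih]

lemma lap_unique_real {P P' : Measure (ι → ℝ)} [IsFiniteMeasure P] [IsFiniteMeasure P']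
    (hP : ∀ᵐ l ∂P, ∀ i, 0 ≤ l i) (hP' : ∀ᵐ l ∂P', ∀ i, 0 ≤ l i)
    (h : ∀ s : ι → ℝ, (∀ i, 0 ≤ s i) → ∫ l, Real.exp (-(∑ i, s i * l i)) ∂P
      = ∫ l, Real.exp (-(∑ i, s i * l i)) ∂P') : P = P' := by
  let a : (ι → ℝ) → (ι → ℝ≥0) := fun l i => (l i).toNNReal
  let b : (ι → ℝ≥0) → (ι → ℝ) := fun l i => (l i : ℝ)
  have ha : Measurable a := by fun_prop
  have hb : Measurable b := by fun_prop
  have hab : ∀ Q : Measure (ι → ℝ), (∀ᵐ l ∂Q, ∀ i, 0 ≤ l i) → (Q.map a).map b = Q := by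
    intro Q hQ
    rw [Measure.map_map hb ha]
    conv_rhs => rw [← Measure.map_id (μ := Q)]
    refine Measure.map_congr ?_
    filter_upwards [hQ] with l hl
    ext i
    simp [a, b, hl i]
  have hi : ∀ Q : Measure (ι → ℝ), (∀ᵐ l ∂Q, ∀ i, 0 ≤ l i) → ∀ s : ι → ℝ≥0,
      ∫ l, ex s l ∂(Q.map a) = ∫ l, Real.exp (-(∑ i, (s i : ℝ) * l i)) ∂Q := by
    intro Q hQ s
    rw [integral_map ha.aemeasurable (ex s).continuous.aestronglyMeasurable]
    refine integral_congr_ae ?_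
    filter_upwards [hQ] with l hl
    simp [ex_apply, a, hl]
  have := lap_unique (P := P.map a) (P' := P'.map a) fun s => by
    rw [hi P hP, hi P' hP']
    exact h (fun i => (s i : ℝ)) fun i => (s i).2
  rw [← hab P hP, ← hab P' hP', this]

noncomputable def Mx (d : ℝ) (p : (ι →₀ ℕ) → ℝ) : Measure (ι → ℝ) :=
  Measure.sum fun m => ENNReal.ofReal (p m) • Gam d m

lemma Mx_nonneg {d : ℝ} (hd : 0 < d) (p : (ι →₀ ℕ) → ℝ) : ∀ᵐ l ∂(Mx d p), ∀ i, 0 ≤ l i := by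
  unfold Mx
  rw [Measure.ae_sum_iff]
  intro m
  exact Measure.ae_smul_measure (Gam_nonneg hd m) _

lemma Mx_finite {d : ℝ} (hd : 0 < d) {p : (ι →₀ ℕ) → ℝ} (hp : ∀ m, 0 ≤ p m) (hs : Summable p) :
    IsFiniteMeasure (Mx d p) := by
  have := fun m : ι →₀ ℕ => isProb_Gam hd m
  refine ⟨?_⟩
  rw [Mx, Measure.sum_apply _ MeasurableSet.univ]
  simp only [Measure.smul_apply, measure_univ, smul_eq_mul, mul_one]
  rw [← ENNReal.ofReal_tsum_of_nonneg hp hs]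
  exact ENNReal.ofReal_lt_top

lemma EB.abs {δ : ℝ} {f : (ι → ℝ) → ℝ} (hE : EB δ f) : EB δ (fun l => |f l|) := by
  obtain ⟨C, hC⟩ := hE
  exact ⟨C, fun l hl => by simpa using hC l hl⟩

lemma Mx_hasSum {d δ ρ : ℝ} (hd : 0 < d) (hδ : δ < d) (hρ : d / (d - δ) ≤ ρ)
    {f : (ι → ℝ) → ℝ} (hE : EB δ f) (hc : Continuous f) {p : (ι →₀ ℕ) → ℝ} (hp : ∀ m, 0 ≤ p m)
    (hs : Summable fun m => p m * ρ ^ m.degree) :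
    HasSum (fun m => p m * hat d f m) (∫ l, f l ∂(Mx d p)) := by
  obtain ⟨C, hC⟩ := GB_hat hd hδ hE.abs hc.abs
  have hr : 0 < d / (d - δ) := div_pos hd (by linarith)
  have hC0 : 0 ≤ C := by
    have := (abs_nonneg _).trans (hC 0)
    simpa using this
  have hi : Integrable f (Mx d p) := by
    refine ⟨hc.measurable.aestronglyMeasurable, ?_⟩
    rw [HasFiniteIntegral, Mx, lintegral_sum_measure]
    have hb : ∀ m, ∫⁻ l, ‖f l‖ₑ ∂(ENNReal.ofReal (p m) • Gam d m)
        ≤ ENNReal.ofReal (C * (p m * ρ ^ m.degree)) := by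
      intro m
      have h1 : ∫⁻ l, ‖f l‖ₑ ∂(Gam d m) = ENNReal.ofReal (hat d (fun l => |f l|) m) :=
        (ofReal_integral_norm_eq_lintegral_enorm (hE.integrable hd hδ hc m)).symm
      rw [lintegral_smul_measure, h1, smul_eq_mul, ← ENNReal.ofReal_mul (hp m)]
      refine ENNReal.ofReal_le_ofReal ?_
      have h2 := (le_abs_self _).trans (hC m)
      have h3 : (d / (d - δ)) ^ m.degree ≤ ρ ^ m.degree := pow_le_pow_left₀ hr.le hρ _
      calc p m * _ ≤ p m * (C * ρ ^ m.degree) := by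
            refine mul_le_mul_of_nonneg_left (h2.trans ?_) (hp m)
            exact mul_le_mul_of_nonneg_left h3 hC0
        _ = _ := by ring
    refine (ENNReal.tsum_le_tsum hb).trans_lt ?_
    rw [← ENNReal.ofReal_tsum_of_nonneg _ (hs.mul_left C)]
    · exact ENNReal.ofReal_lt_top
    · intro m
      have := hp m
      have : 0 ≤ ρ := hr.le.trans hρ
      positivity
  have h := hasSum_integral_measure hi
  have e : (fun m => p m * hat d f m) = fun m => ∫ l, f l ∂(ENNReal.ofReal (p m) • Gam d m) := by
    ext m
    rw [integral_smul_measure, ENNReal.toReal_ofReal (hp m), smul_eq_mul, hat]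
  rw [e]
  exact h

lemma EB_exp {s : ι → ℝ} (hs : ∀ i, 0 ≤ s i) :
    EB 0 (fun l : ι → ℝ => Real.exp (-(∑ i, s i * l i))) := by
  refine ⟨1, fun l hl => ?_⟩
  rw [Real.abs_exp, zero_mul, Real.exp_zero, mul_one, Real.exp_le_one_iff, neg_nonpos]
  exact Finset.sum_nonneg fun i _ => mul_nonneg (hs i) (hl i)

lemma lap_det {d : ℝ} (hd : 0 < d) {s : ι → ℝ} (hs : ∀ i, 0 ≤ s i) (G B : Matrix ι ι ℝ)
    (hG : IsUnit G.det) (hB : B = 1 - d⁻¹ • G⁻¹) :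
    (∏ i, d / (d + s i)) * ((1 - B).det *
      ((1 - Matrix.diagonal (fun i => d / (d + s i)) * B).det)⁻¹)
      = ((1 + Matrix.diagonal s * G).det)⁻¹ := by
  have hx : ∀ i, 0 < d + s i := fun i => add_pos_of_pos_of_nonneg hd (hs i)
  have h1 : 1 - Matrix.diagonal (fun i => d / (d + s i)) * B
      = Matrix.diagonal (fun i => d / (d + s i)) * ((d⁻¹ • G⁻¹) * (1 + G * Matrix.diagonal s)) := by
    have e1 : (d⁻¹ • G⁻¹) * (1 + G * Matrix.diagonal s)
        = d⁻¹ • G⁻¹ + d⁻¹ • Matrix.diagonal s := by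
      rw [mul_add, mul_one, Matrix.smul_mul, ← mul_assoc, Matrix.nonsing_inv_mul _ hG, one_mul]
    have e2 : Matrix.diagonal (fun i => d / (d + s i)) * (d⁻¹ • Matrix.diagonal s)
        = 1 - Matrix.diagonal (fun i => d / (d + s i)) := by
      rw [← Matrix.diagonal_smul, Matrix.diagonal_mul_diagonal, ← Matrix.diagonal_one,
        Matrix.diagonal_sub]
      congr 1
      ext i
      have := (hx i).ne'
      simp only [Pi.smul_apply, smul_eq_mul]
      field_simp
      ring
    rw [e1, mul_add, e2, hB, mul_sub, mul_one]
    abel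
  have h2 : (1 + G * Matrix.diagonal s).det = (1 + Matrix.diagonal s * G).det :=
    Matrix.det_one_add_mul_comm _ _
  have h3 : (1 - B) = d⁻¹ • G⁻¹ := by rw [hB]; abel
  have h4 : (d⁻¹ • G⁻¹).det ≠ 0 := by
    rw [Matrix.det_smul]
    refine mul_ne_zero (pow_ne_zero _ (inv_ne_zero hd.ne')) ?_
    exact (Matrix.isUnit_nonsing_inv_det _ hG).ne_zero
  have h5 : (∏ i, d / (d + s i)) ≠ 0 := Finset.prod_ne_zero_iff.2 fun i _ => (div_pos hd (hx i)).ne'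
  rw [h3, h1, Matrix.det_mul, Matrix.det_mul, Matrix.det_diagonal, h2, mul_inv, mul_inv]
  generalize (d⁻¹ • G⁻¹).det = u at h4 ⊢
  generalize (∏ i, d / (d + s i)) = w at h5 ⊢
  generalize ((1 + Matrix.diagonal s * G).det)⁻¹ = z
  field_simp

lemma law {d : ℝ} (hd : 0 < d) (G B : Matrix ι ι ℝ)
    (hG : IsUnit G.det) (hB : B = 1 - d⁻¹ • G⁻¹) (hQ : wN (gw 1) (QQ id B) ≠ ∞)
    (hN : NN (QQ id B)) {P : Measure (ι → ℝ)} [IsFiniteMeasure P]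
    (hP : ∀ᵐ l ∂P, ∀ i, 0 ≤ l i)
    (hlap : ∀ s : ι → ℝ, (∀ i, 0 ≤ s i) → ∫ l, Real.exp (-(∑ i, s i * l i)) ∂P
      = ((1 + Matrix.diagonal s * G).det)⁻¹) :
    P = Mx d (fun m => MvPowerSeries.coeff m (Psi B)) := by
  have hNP := NN_Psi B hQ hN
  have hw : wN (gw (ENNReal.ofReal 1)) (Psi B) ≠ ∞ := by
    rw [Psi, wN_C_mul]
    exact ENNReal.mul_ne_top (by simp) (by simpa using hQ)
  have hs1 : Summable fun m => MvPowerSeries.coeff m (Psi B) * (1 : ℝ) ^ m.degree := by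
    refine (summable_coeff zero_le_one hw).congr fun m => ?_
    rw [abs_of_nonneg (hNP m)]
  have hfin : IsFiniteMeasure (Mx d (fun m => MvPowerSeries.coeff m (Psi B))) :=
    Mx_finite hd hNP (by simpa using hs1)
  refine lap_unique_real hP (Mx_nonneg hd _) fun s hs => ?_
  have hx : ∀ i, 0 < d + s i := fun i => add_pos_of_pos_of_nonneg hd (hs i)
  have h := Mx_hasSum (ρ := 1) hd hd (by simp [hd.ne']) (EB_exp hs) (by fun_prop) hNP hs1
  rw [hlap s hs, ← h.tsum_eq, ← lap_det hd hs G B hG hB,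
    ← ev_Psi (fun i => (div_pos hd (hx i)).le)
      (fun i => (div_le_one (hx i)).2 (le_add_of_nonneg_right (hs i))) B hQ, ev, pr, ← tsum_mul_left]
  refine tsum_congr fun m => ?_
  rw [hat, integral_expsum hd hx]
  simp only [pow_succ, Finset.prod_mul_distrib, mon]
  ring

end KP

namespace KP

open scoped ENNReal NNReal

variable {ι : Type*} [Fintype ι] [DecidableEq ι]

lemma pr_neg (Y : MvPowerSeries ι ℝ) (g : (ι →₀ ℕ) → ℝ) : pr Y (fun m => - g m) = - pr Y g := by
  simp [pr, tsum_neg]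

lemma mono_step {d C ρ ρ' I0 I1 : ℝ} {E : ℝ≥0∞} (hd : 0 < d) (hρ : 0 < ρ) (hρ' : ρ < ρ')
    (hE : E ≠ ∞) {g : (ι →₀ ℕ) → ℝ} (hg : ∀ m, |g m| ≤ C * ρ ^ m.degree)
    {G G' B : ℝ → Matrix ι ι ℝ}
    (hderiv : ∀ i j, ∀ α ∈ Set.Icc (0 : ℝ) 1,
      HasDerivWithinAt (fun a => G a i j) (G' α i j) (Set.Icc (0 : ℝ) 1) α)
    (hsign : ∀ i j, (∀ α ∈ Set.Icc (0 : ℝ) 1, 0 ≤ G' α i j) ∨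
      (∀ α ∈ Set.Icc (0 : ℝ) 1, G' α i j ≤ 0))
    (hCD : ∀ α ∈ Set.Icc (0 : ℝ) 1, CD (fun t => Psi (B t))
      (∑ i, ∑ j, MvPowerSeries.C (d * G' α i j) * UU (B α) i j) (Set.Icc 0 1) α)
    (hU : ∀ α ∈ Set.Icc (0 : ℝ) 1, ∀ i j, wN (gw (ENNReal.ofReal ρ')) (UU (B α) i j) ≤ E)
    (hs : ∀ α ∈ Set.Icc (0 : ℝ) 1, ∀ i j, 0 ≤ G' α i j * pr (UU (B α) i j) g)
    (h0 : HasSum (fun m => MvPowerSeries.coeff m (Psi (B 0)) * g m) I0)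
    (h1 : HasSum (fun m => MvPowerSeries.coeff m (Psi (B 1)) * g m) I1) : I0 ≤ I1 := by
  have hsg : ∀ i j, ∃ s : ℝ, ∀ α ∈ Set.Icc (0 : ℝ) 1, s * G' α i j = |G' α i j| := by
    intro i j
    rcases hsign i j with h | h
    · exact ⟨1, fun α hα => by rw [abs_of_nonneg (h α hα), one_mul]⟩
    · exact ⟨-1, fun α hα => by rw [abs_of_nonpos (h α hα)]; ring⟩
  choose s hs' using hsg
  set q : ℝ := ρ / ρ' with hq
  have hq0 : 0 ≤ q := by have : 0 < ρ' := hρ.trans hρ'; positivity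
  have hq1 : q < 1 := by rw [hq, div_lt_one (hρ.trans hρ')]; exact hρ'
  let e : ℕ → ℝ := fun N => d * (C * q ^ N * E.toReal)
  let Φ : ℕ → ℝ → ℝ := fun N a => ∑ m ∈ SN N, MvPowerSeries.coeff m (Psi (B a)) * g m
  let S : ℝ → ℝ := fun a => ∑ i, ∑ j, s i j * G a i j
  have hΦ : ∀ N, ∀ α ∈ Set.Icc (0 : ℝ) 1, HasDerivWithinAt (fun a => Φ N a + e N * S a)
      (∑ i, ∑ j, (d * G' α i j * (∑ m ∈ SN N, MvPowerSeries.coeff m (UU (B α) i j) * g m)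
        + e N * (s i j * G' α i j))) (Set.Icc 0 1) α := by
    intro N α hα
    have a1 : HasDerivWithinAt (Φ N) (∑ m ∈ SN N, MvPowerSeries.coeff m
        (∑ i, ∑ j, MvPowerSeries.C (d * G' α i j) * UU (B α) i j) * g m) (Set.Icc 0 1) α :=
      HasDerivWithinAt.fun_sum fun m _ => (hCD α hα m).mul_const _
    have a2 : HasDerivWithinAt S (∑ i, ∑ j, s i j * G' α i j) (Set.Icc 0 1) α :=
      HasDerivWithinAt.fun_sum fun i _ => HasDerivWithinAt.fun_sum fun j _ =>
        (hderiv i j α hα).const_mul _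
    refine (a1.add (a2.const_mul (e N))).congr_deriv ?_
    simp only [Finset.sum_add_distrib, Finset.mul_sum, map_sum, MvPowerSeries.coeff_C_mul,
      Finset.sum_mul]
    congr 1
    rw [Finset.sum_comm]
    refine Finset.sum_congr rfl fun i _ => ?_
    rw [Finset.sum_comm]
    refine Finset.sum_congr rfl fun j _ => Finset.sum_congr rfl fun m _ => ?_
    ring
  have hmono : ∀ N, Φ N 0 + e N * S 0 ≤ Φ N 1 + e N * S 1 := by
    intro N
    have hm : MonotoneOn (fun a => Φ N a + e N * S a) (Set.Icc 0 1) := by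
      refine monotoneOn_of_hasDerivWithinAt_nonneg (convex_Icc 0 1)
        (fun α hα => (hΦ N α hα).continuousWithinAt)
        (fun α hα => (hΦ N α (interior_subset hα)).mono interior_subset) ?_
      intro α hα
      have hα := interior_subset hα
      refine Finset.sum_nonneg fun i _ => Finset.sum_nonneg fun j _ => ?_
      have ht := pr_tail hρ hρ' hE (hU α hα i j) hg N
      rw [hs' i j α hα]
      set P := pr (UU (B α) i j) g
      set R := ∑ m ∈ SN N, MvPowerSeries.coeff m (UU (B α) i j) * g m
      set x := G' α i j
      set c := C * (ρ / ρ') ^ N * E.toReal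
      have h3 : x * (P - R) ≤ |x| * c := by
        calc x * (P - R) ≤ |x * (P - R)| := le_abs_self _
          _ = |x| * |P - R| := abs_mul _ _
          _ ≤ _ := mul_le_mul_of_nonneg_left ht (abs_nonneg _)
      have h4 := hs α hα i j
      have : d * x * R + d * c * |x| = d * (x * P + (|x| * c - x * (P - R))) := by ring
      show 0 ≤ d * x * R + d * c * |x|
      rw [this]
      exact mul_nonneg hd.le (add_nonneg h4 (sub_nonneg.2 h3))
    exact hm (by simp) (by simp) zero_le_one
  have he : Tendsto e atTop (nhds 0) := by
    have := ((tendsto_pow_atTop_nhds_zero_of_lt_one hq0 hq1).const_mul (d * C * E.toReal))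
    rw [mul_zero] at this
    refine this.congr fun N => ?_
    simp only [e]; ring
  have l0 : Tendsto (fun N => Φ N 0 + e N * S 0) atTop (nhds (I0 + 0 * S 0)) :=
    (h0.comp tendsto_SN).add (he.mul_const _)
  have l1 : Tendsto (fun N => Φ N 1 + e N * S 1) atTop (nhds (I1 + 0 * S 1)) :=
    (h1.comp tendsto_SN).add (he.mul_const _)
  simpa using le_of_tendsto_of_tendsto' l0 l1 hmono

lemma inv_deriv {G G' : ℝ → Matrix ι ι ℝ} {S : Set ℝ} (hS : UniqueDiffOn ℝ S)
    (hderiv : ∀ i j, ∀ α ∈ S, HasDerivWithinAt (fun a => G a i j) (G' α i j) S α)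
    (hinv : ∀ α ∈ S, IsUnit (G α).det) (α : ℝ) (hα : α ∈ S) (i j : ι) :
    HasDerivWithinAt (fun a => (G a)⁻¹ i j) ((-((G α)⁻¹ * G' α * (G α)⁻¹)) i j) S α := by
  have hdet : ∀ M : ℝ → Matrix ι ι ℝ, (∀ i j, DifferentiableWithinAt ℝ (fun a => M a i j) S α) →
      DifferentiableWithinAt ℝ (fun a => (M a).det) S α := by
    intro M hM
    simp only [Matrix.det_apply]
    refine DifferentiableWithinAt.fun_sum fun p _ => ?_
    refine DifferentiableWithinAt.const_smul ?_ _
    exact DifferentiableWithinAt.fun_finset_prod fun k _ => hM _ _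
  have hG : ∀ i j, DifferentiableWithinAt ℝ (fun a => G a i j) S α :=
    fun i j => (hderiv i j α hα).differentiableWithinAt
  have hA : ∀ i j, DifferentiableWithinAt ℝ (fun a => (G a)⁻¹ i j) S α := by
    intro i j
    have : ∀ a, (G a)⁻¹ i j = ((G a).det)⁻¹ * (G a).adjugate i j := by
      intro a
      rw [Matrix.inv_def]; simp
    simp only [this]
    refine DifferentiableWithinAt.mul ?_ ?_
    · exact (hdet G hG).inv (hinv α hα).ne_zero
    · simp only [Matrix.adjugate_apply]
      refine hdet _ fun k l => ?_
      simp only [Matrix.updateRow_apply]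
      split_ifs
      · exact differentiableWithinAt_const _
      · exact hG k l
  set A' : Matrix ι ι ℝ := Matrix.of fun i j => derivWithin (fun a => (G a)⁻¹ i j) S α with hA'
  have hA1 : ∀ i j, HasDerivWithinAt (fun a => (G a)⁻¹ i j) (A' i j) S α :=
    fun i j => (hA i j).hasDerivWithinAt
  have key : A' * G α + (G α)⁻¹ * G' α = 0 := by
    ext i j
    have h1 : HasDerivWithinAt (fun a => ∑ k, (G a)⁻¹ i k * G a k j)
        (∑ k, (A' i k * G α k j + (G α)⁻¹ i k * G' α k j)) S α :=
      HasDerivWithinAt.fun_sum fun k _ => (hA1 i k).mul (hderiv k j α hα)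
    have h2 : HasDerivWithinAt (fun a => ∑ k, (G a)⁻¹ i k * G a k j) 0 S α := by
      refine (hasDerivWithinAt_const α S ((1 : Matrix ι ι ℝ) i j)).congr_of_mem ?_ hα
      intro a ha
      rw [← Matrix.nonsing_inv_mul _ (hinv a ha), Matrix.mul_apply]
    have := (hS α hα).eq_deriv _ h1 h2
    rw [Matrix.add_apply, Matrix.mul_apply, Matrix.mul_apply, ← Finset.sum_add_distrib]
    simpa using this
  have : A' = -((G α)⁻¹ * G' α * (G α)⁻¹) := by
    have h := congrArg (· * (G α)⁻¹) key
    simp only [add_mul, zero_mul, mul_assoc, Matrix.mul_nonsing_inv _ (hinv α hα), mul_one] at h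
    rw [mul_assoc]
    exact eq_neg_of_add_eq_zero_left h
  rw [← this]
  exact hA1 i j

end KP

namespace KP

open scoped ENNReal NNReal

lemma wN_mono_gw {σ : Type*} {ρ ρ' : ℝ≥0∞} (h : ρ ≤ ρ') (Y : MvPowerSeries σ ℝ) :
    wN (gw ρ) Y ≤ wN (gw ρ') Y := by
  unfold wN gw
  refine ENNReal.tsum_le_tsum fun m => ?_
  gcongr

/-- All the bounds required for the kernel `B = 1 - G⁻¹ / d`. -/
lemma bounds {n : ℕ} {d ε : ℝ} (hd : 0 < d) (hε : 0 < ε) (hεd : ε < d)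
    {G B : Matrix (Fin n) (Fin n) ℝ} (hnn : ∀ i j, 0 ≤ G i j) (hG : IsUnit G.det)
    (hM : ∀ i j, i ≠ j → G⁻¹ i j ≤ 0) (hA : ∀ i j, |G⁻¹ i j| ≤ d)
    (hu : ∀ i, ε * ∑ j, G i j ≤ 1 / 2) (hB : B = 1 - d⁻¹ • G⁻¹)
    {K P T : ℝ≥0∞} (hK : K = ENNReal.ofReal (d / ε))
    (hP : P = ENNReal.ofReal (n.factorial : ℝ) * K ^ n)
    (hT : T = (Fintype.card (Fin n)) * (ENNReal.ofReal 2 * K)) :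
    (∀ i j, 0 ≤ B i j) ∧ NN (QQ id B) ∧
    wN (gw (ENNReal.ofReal (d / (d - ε)))) (QQ id B) ≤ K ^ n ∧
    wN (gw (ENNReal.ofReal (d / (d - ε)))) (Psi B) ≤ P ∧
    ∀ i j, wN (gw (ENNReal.ofReal (d / (d - ε)))) (TT B i j) ≤ T := by
  have h1B : ∀ i j, |(1 - B) i j| ≤ 1 := by
    intro i j
    rw [hB]
    simp only [sub_sub_cancel, Matrix.smul_apply, smul_eq_mul, abs_mul, abs_inv, abs_of_pos hd]
    rw [inv_mul_le_iff₀ hd]; simpa using hA i j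
  have hB0 : ∀ i j, 0 ≤ B i j := by
    intro i j
    by_cases h : i = j
    · subst h
      have := abs_le.1 (h1B i i)
      simp at this
      linarith
    · have := hM i j h
      rw [hB]
      simp only [Matrix.sub_apply, Matrix.one_apply_ne h, Matrix.smul_apply, smul_eq_mul, zero_sub]
      have : 0 ≤ d⁻¹ * -(G⁻¹ i j) := mul_nonneg (by positivity) (by linarith)
      linarith
  have hB2 : ∀ i j, ‖B i j‖ₑ ≤ ENNReal.ofReal 2 := by
    intro i j
    rw [Real.enorm_of_nonneg (hB0 i j)]
    apply ENNReal.ofReal_le_ofReal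
    have := (abs_le.1 (h1B i j)).1
    by_cases h : i = j
    · subst h; simp at this; linarith
    · simp [Matrix.one_apply_ne h] at this; linarith
  set u : Fin n → ℝ := fun i => ∑ j, G i j with hudef
  have hu0 : ∀ i, 0 ≤ u i := fun i => Finset.sum_nonneg fun j _ => hnn i j
  have hBu : ∀ i, ∑ l, B i l * u l = u i - 1 / d := by
    intro i
    have e1 : u = G *ᵥ 1 := by
      ext i; simp [hudef, Matrix.mulVec, dotProduct]
    have e2 : B *ᵥ u = u - d⁻¹ • (1 : Fin n → ℝ) := by
      rw [hB, Matrix.sub_mulVec, Matrix.one_mulVec, Matrix.smul_mulVec]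
      congr 2
      rw [e1, Matrix.mulVec_mulVec, Matrix.nonsing_inv_mul _ hG, Matrix.one_mulVec]
    have := congrFun e2 i
    simpa [Matrix.mulVec, dotProduct] using this
  have hdε : 0 < d - ε := by linarith
  set r := d / (d - ε) with hr
  have hr0 : 0 ≤ r := by positivity
  set v : Fin n → ℝ≥0∞ := fun i => ENNReal.ofReal (2 * d * u i) with hv
  have hv1 : ∀ i, 1 + ENNReal.ofReal r * ∑ l, ‖B i l‖ₑ * v l ≤ v i := by
    intro i
    have e : ∑ l, ‖B i l‖ₑ * v l = ENNReal.ofReal (∑ l, B i l * (2 * d * u l)) := by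
      rw [ENNReal.ofReal_sum_of_nonneg]
      · refine Finset.sum_congr rfl fun l _ => ?_
        rw [Real.enorm_of_nonneg (hB0 i l), hv, ENNReal.ofReal_mul (hB0 i l)]
      · intro l _
        have := hB0 i l
        have := hu0 l
        positivity
    have e2 : ∑ l, B i l * (2 * d * u l) = 2 * d * (u i - 1 / d) := by
      rw [← hBu, Finset.mul_sum]
      exact Finset.sum_congr rfl fun l _ => by ring
    have e3 : 0 ≤ ∑ l, B i l * (2 * d * u l) := by
      refine Finset.sum_nonneg fun l _ => ?_
      have := hB0 i l
      have := hu0 l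
      positivity
    rw [e, ← ENNReal.ofReal_mul hr0, ← ENNReal.ofReal_one,
      ← ENNReal.ofReal_add zero_le_one (mul_nonneg hr0 e3), e2]
    apply ENNReal.ofReal_le_ofReal
    have h2 : 2 * d * (u i - 1 / d) = 2 * d * u i - 2 := by field_simp
    rw [h2, hr, div_mul_eq_mul_div, ← le_sub_iff_add_le', div_le_iff₀ hdε]
    have h3 := hu i
    have : 2 * d * (ε * u i) ≤ 2 * d * (1 / 2) := by gcongr
    nlinarith
  have hvK : ∀ i, v i ≤ K := by
    intro i
    rw [hK]
    apply ENNReal.ofReal_le_ofReal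
    rw [le_div_iff₀ hε]
    have h3 := hu i
    have : 2 * d * (ε * u i) ≤ 2 * d * (1 / 2) := by gcongr
    nlinarith
  obtain ⟨q1, q2⟩ := QQ_props (ENNReal.ofReal r) K n id B hB0 v hv1 hvK
  have hW : ∀ i j, wN (gw (ENNReal.ofReal r)) (WW id B i j) ≤ K := fun i j =>
    (wN_WW id B _ v hv1 i j).trans (hvK i)
  refine ⟨hB0, q1, q2, ?_, ?_⟩
  · unfold Psi
    rw [wN_C_mul, hP]
    gcongr
    rw [← ofReal_norm, Real.norm_eq_abs]
    apply ENNReal.ofReal_le_ofReal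
    have := Matrix.det_le (A := 1 - B) (abv := (AbsoluteValue.abs : AbsoluteValue ℝ ℝ)) (x := 1) h1B
    simpa using this
  · intro i j
    rw [hT]
    exact wN_TT_le B hW hB2 i j

/-- derivative facts -/
lemma upd_deriv {n : ℕ} {f : (Fin n → ℝ) → ℝ} (hf : Differentiable ℝ f) (i : Fin n)
    (y : Fin n → ℝ) (t : ℝ) :
    HasDerivAt (fun t => f (Function.update y i t))
      (fderiv ℝ f (Function.update y i t) (Pi.single i 1)) t :=
  (hf (Function.update y i t)).hasFDerivAt.comp_hasDerivAt t (hasDerivAt_update y i t)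

lemma contDiff_pd {n : ℕ} {f : (Fin n → ℝ) → ℝ} (hf : ContDiff ℝ 2 f) (i : Fin n) :
    ContDiff ℝ 1 (fun x => fderiv ℝ f x (Pi.single i 1)) :=
  (hf.fderiv_right (m := 1) (by norm_num)).clm_apply contDiff_const

lemma cont_pd {n : ℕ} {f : (Fin n → ℝ) → ℝ} (hf : ContDiff ℝ 1 f) (i : Fin n) :
    Continuous (fun x => fderiv ℝ f x (Pi.single i 1)) :=
  (hf.continuous_fderiv (by norm_num)).clm_apply continuous_const

lemma growth {n : ℕ} {f : (Fin n → ℝ) → ℝ} (hc : Continuous f)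
    (h : Tendsto (fun l : Fin n → ℝ => Real.log (1 + |f l|) / ‖l‖)
    (cocompact (Fin n → ℝ) ⊓ Filter.principal {l | ∀ i, 0 ≤ l i}) (nhds 0))
    {δ : ℝ} (hδ : 0 < δ) : EB δ f := by
  have h1 := h.eventually (gt_mem_nhds hδ)
  rw [eventually_inf_principal] at h1
  obtain ⟨S, hS, hSc⟩ := mem_cocompact.1 h1
  obtain ⟨M, hM⟩ := hS.exists_bound_of_continuousOn hc.continuousOn
  refine ⟨|M| + |f 0| + 1, fun l hl => ?_⟩
  have hsum : 0 ≤ ∑ i, l i := Finset.sum_nonneg fun i _ => hl i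
  have he : 1 ≤ Real.exp (δ * ∑ i, l i) := Real.one_le_exp (by positivity)
  have hgen : ∀ {a b c e : ℝ}, 0 ≤ b → 0 ≤ c → 1 ≤ e → (a ≤ b ∨ a ≤ c ∨ a ≤ e) →
      a ≤ (b + c + 1) * e := by
    intro a b c e hb hc he h
    rcases h with h | h | h <;> nlinarith [mul_le_mul_of_nonneg_left he hb, mul_le_mul_of_nonneg_left he hc]
  refine hgen (abs_nonneg _) (abs_nonneg _) he ?_
  by_cases hlS : l ∈ S
  · left
    exact (hM l hlS).trans (le_abs_self M)
  · right
    by_cases hl0 : l = 0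
    · left; rw [hl0]
    · right
      have h2 : Real.log (1 + |f l|) / ‖l‖ < δ := hSc hlS hl
      have hn : 0 < ‖l‖ := norm_pos_iff.2 hl0
      rw [div_lt_iff₀ hn] at h2
      have h3 : ‖l‖ ≤ ∑ i, l i := by
        rw [pi_norm_le_iff_of_nonneg hsum]
        intro i
        rw [Real.norm_eq_abs, abs_of_nonneg (hl i)]
        exact Finset.single_le_sum (fun i _ => hl i) (Finset.mem_univ i)
      have h4 : Real.log (1 + |f l|) ≤ δ * ∑ i, l i := h2.le.trans (by gcongr)
      have h5 : 1 + |f l| ≤ Real.exp (δ * ∑ i, l i) :=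
        (Real.log_le_iff_le_exp (by positivity)).1 h4
      linarith

end KP

/-- **Kahane-type inequality for 1-permanental vectors.** Let
`{G_α : α ∈ [0,1]}` be a family of inverse M-matrices with positive definite symmetric part,
entrywise differentiable in `α` with derivatives of constant sign, and let `ℓ_α` be
1-permanental with kernel `G_α`. Let `f` be `C²` with `f` and all first and second partial
derivatives of subexponential growth. If for each `i` either
(`dG_{α,ii}/dα ≥ 0` and `∂ᵢf + lᵢ∂ᵢᵢf ≥ 0`) or (`dG_{α,ii}/dα ≤ 0` and `∂ᵢf + lᵢ∂ᵢᵢf ≤ 0`),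
and for each `i ≠ j` either (`dG_{α,ij}/dα ≥ 0` and `∂ᵢⱼf ≥ 0`) or
(`dG_{α,ij}/dα ≤ 0` and `∂ᵢⱼf ≤ 0`), then `E[f(ℓ₁)] ≥ E[f(ℓ₀)]`. -/
theorem kahane_onePermanental {n : ℕ}
    (G : ℝ → Matrix (Fin n) (Fin n) ℝ) (G' : ℝ → Matrix (Fin n) (Fin n) ℝ)
    (hderiv : ∀ i j, ∀ α ∈ Set.Icc (0 : ℝ) 1,
      HasDerivWithinAt (fun a => G a i j) (G' α i j) (Set.Icc (0 : ℝ) 1) α)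
    (hsign : ∀ i j, (∀ α ∈ Set.Icc (0 : ℝ) 1, 0 ≤ G' α i j) ∨
      (∀ α ∈ Set.Icc (0 : ℝ) 1, G' α i j ≤ 0))
    (hnn : ∀ α ∈ Set.Icc (0 : ℝ) 1, ∀ i j, 0 ≤ G α i j)
    (hinvble : ∀ α ∈ Set.Icc (0 : ℝ) 1, IsUnit (G α).det)
    (hMmat : ∀ α ∈ Set.Icc (0 : ℝ) 1, ∀ i j, i ≠ j → (G α)⁻¹ i j ≤ 0)
    (hpd : ∀ α ∈ Set.Icc (0 : ℝ) 1, ∀ x : Fin n → ℝ, x ≠ 0 → 0 < x ⬝ᵥ (G α).mulVec x)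
    {Ω : Type} [MeasurableSpace Ω] (μ : Measure Ω) [IsProbabilityMeasure μ]
    (ℓ : ℝ → Ω → Fin n → ℝ) (hmeas : ∀ α, Measurable (ℓ α))
    (hpos : ∀ α ω i, 0 ≤ ℓ α ω i)
    (hperm : ∀ α ∈ Set.Icc (0 : ℝ) 1, ∀ lam : Fin n → ℝ, (∀ i, 0 ≤ lam i) →
      ∫ ω, Real.exp (-(∑ i, lam i * ℓ α ω i)) ∂μ =
        ((1 + Matrix.diagonal lam * G α).det)⁻¹)
    (f : (Fin n → ℝ) → ℝ) (hf : ContDiff ℝ 2 f)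
    (hgrowf : HasSubexpGrowth f)
    (hgrow1 : ∀ i, HasSubexpGrowth (pd i f))
    (hgrow2 : ∀ i j, HasSubexpGrowth (pd2 i j f))
    (hdiagsign : ∀ i : Fin n,
      ((∀ α ∈ Set.Icc (0 : ℝ) 1, 0 ≤ G' α i i) ∧
        (∀ l : Fin n → ℝ, (∀ i', 0 ≤ l i') → 0 ≤ pd i f l + l i * pd2 i i f l)) ∨
      ((∀ α ∈ Set.Icc (0 : ℝ) 1, G' α i i ≤ 0) ∧
        (∀ l : Fin n → ℝ, (∀ i', 0 ≤ l i') → pd i f l + l i * pd2 i i f l ≤ 0)))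
    (hoffsign : ∀ i j : Fin n, i ≠ j →
      ((∀ α ∈ Set.Icc (0 : ℝ) 1, 0 ≤ G' α i j) ∧
        (∀ l : Fin n → ℝ, (∀ i', 0 ≤ l i') → 0 ≤ pd2 i j f l)) ∨
      ((∀ α ∈ Set.Icc (0 : ℝ) 1, G' α i j ≤ 0) ∧
        (∀ l : Fin n → ℝ, (∀ i', 0 ≤ l i') → pd2 i j f l ≤ 0))) :
    ∫ ω, f (ℓ 0 ω) ∂μ ≤ ∫ ω, f (ℓ 1 ω) ∂μ := by
  classical
  set I : Set ℝ := Set.Icc (0 : ℝ) 1 with hI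
  have hI0 : (0 : ℝ) ∈ I := by simp [hI]
  have hI1 : (1 : ℝ) ∈ I := by simp [hI]
  have hIu : UniqueDiffOn ℝ I := uniqueDiffOn_Icc zero_lt_one
  have hAd := KP.inv_deriv hIu hderiv hinvble
  -- uniform bounds on the entries
  have hbd : ∀ F : ℝ → Matrix (Fin n) (Fin n) ℝ,
      (∀ i j, ContinuousOn (fun a => F a i j) I) → ∃ D, 0 < D ∧ ∀ α ∈ I, ∀ i j, |F α i j| ≤ D := by
    intro F hF
    have : ∀ i j, ∃ C, ∀ α ∈ I, |F α i j| ≤ C := fun i j =>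
      isCompact_Icc.exists_bound_of_continuousOn (hF i j)
    choose C hC using this
    refine ⟨(∑ i, ∑ j, |C i j|) + 1, by positivity, fun α hα i j => ?_⟩
    have h1 : |C i j| ≤ ∑ j, |C i j| :=
      Finset.single_le_sum (f := fun j => |C i j|) (fun j _ => abs_nonneg _) (Finset.mem_univ j)
    have h2 : ∑ j, |C i j| ≤ ∑ i, ∑ j, |C i j| :=
      Finset.single_le_sum (f := fun i => ∑ j, |C i j|)
        (fun i _ => Finset.sum_nonneg fun j _ => abs_nonneg _) (Finset.mem_univ i)
    have := hC i j α hα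
    have := le_abs_self (C i j)
    linarith
  obtain ⟨d, hd, hdA⟩ := hbd (fun a => (G a)⁻¹)
    (fun i j α hα => (hAd α hα i j).continuousWithinAt)
  obtain ⟨g0, hg0, hgG⟩ := hbd G (fun i j α hα => (hderiv i j α hα).continuousWithinAt)
  obtain ⟨ε, hε, hεd, hεg⟩ : ∃ ε : ℝ, 0 < ε ∧ ε < d ∧ ε * (n * g0) ≤ 1 / 2 := by
    refine ⟨min (d / 2) (1 / (2 * (n * g0 + 1))), by positivity,
      (min_le_left _ _).trans_lt (by linarith), ?_⟩
    calc min (d / 2) (1 / (2 * (n * g0 + 1))) * (n * g0)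
        ≤ 1 / (2 * (n * g0 + 1)) * (n * g0) := by
          gcongr
          exact min_le_right _ _
      _ ≤ 1 / 2 := by
          rw [div_mul_eq_mul_div, div_le_div_iff₀ (by positivity) (by norm_num)]
          linarith
  have hu : ∀ α ∈ I, ∀ i, ε * ∑ j, G α i j ≤ 1 / 2 := by
    intro α hα i
    refine le_trans ?_ hεg
    gcongr
    calc ∑ j, G α i j ≤ ∑ _j : Fin n, g0 :=
          Finset.sum_le_sum fun j _ => (le_abs_self _).trans (hgG α hα i j)
      _ = n * g0 := by simp
  set B : ℝ → Matrix (Fin n) (Fin n) ℝ := fun α => 1 - d⁻¹ • (G α)⁻¹ with hBdef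
  set K : ENNReal := ENNReal.ofReal (d / ε) with hK
  set P : ENNReal := ENNReal.ofReal (n.factorial : ℝ) * K ^ n with hP
  set T : ENNReal := (Fintype.card (Fin n)) * (ENNReal.ofReal 2 * K) with hT
  have hKt : K ≠ ⊤ := ENNReal.ofReal_ne_top
  have hPt : P ≠ ⊤ := ENNReal.mul_ne_top ENNReal.ofReal_ne_top (ENNReal.pow_ne_top hKt)
  have hTt : T ≠ ⊤ := ENNReal.mul_ne_top (ENNReal.natCast_ne_top _)
    (ENNReal.mul_ne_top ENNReal.ofReal_ne_top hKt)
  have hb := fun α (hα : α ∈ I) => KP.bounds (B := B α) hd hε hεd (hnn α hα) (hinvble α hα)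
    (hMmat α hα) (hdA α hα) (hu α hα) rfl hK hP hT
  set ρ' : ℝ := d / (d - ε) with hρ'
  set δ : ℝ := ε / 2 with hδ
  have hδ0 : 0 < δ := by positivity
  have hδd : δ < d := by linarith
  set ρ : ℝ := d / (d - δ) with hρ
  have hρ1 : 1 ≤ ρ := by
    rw [hρ, le_div_iff₀ (by linarith)]; linarith
  have hρρ : ρ < ρ' := by
    rw [hρ, hρ']
    exact div_lt_div_of_pos_left hd (by linarith) (by linarith)
  have hρ0 : 0 < ρ := by linarith
  have hmonoρ : ∀ Y : MvPowerSeries (Fin n) ℝ, KP.wN (KP.gw (ENNReal.ofReal ρ)) Y ≤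
      KP.wN (KP.gw (ENNReal.ofReal ρ')) Y :=
    fun Y => KP.wN_mono_gw (ENNReal.ofReal_le_ofReal hρρ.le) Y
  have hmono1 : ∀ Y : MvPowerSeries (Fin n) ℝ, KP.wN (KP.gw 1) Y ≤
      KP.wN (KP.gw (ENNReal.ofReal ρ')) Y := by
    intro Y
    refine KP.wN_mono_gw ?_ Y
    rw [← ENNReal.ofReal_one]
    exact ENNReal.ofReal_le_ofReal (by linarith)
  have hQ1 : ∀ α ∈ I, KP.wN (KP.gw 1) (KP.QQ id (B α)) ≠ ⊤ := fun α hα =>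
    ne_top_of_le_ne_top (ENNReal.pow_ne_top hKt) ((hmono1 _).trans (hb α hα).2.2.1)
  have hΨ0 : ∀ α ∈ I, KP.NN (KP.Psi (B α)) := fun α hα =>
    KP.NN_Psi _ (hQ1 α hα) (hb α hα).2.1
  have hΨρ : ∀ α ∈ I, KP.wN (KP.gw (ENNReal.ofReal ρ)) (KP.Psi (B α)) ≠ ⊤ := fun α hα =>
    ne_top_of_le_ne_top hPt ((hmonoρ _).trans (hb α hα).2.2.2.1)
  have hTρ : ∀ α ∈ I, ∀ i j, KP.wN (KP.gw (ENNReal.ofReal ρ)) (KP.TT (B α) i j) ≠ ⊤ :=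
    fun α hα i j => ne_top_of_le_ne_top hTt ((hmonoρ _).trans ((hb α hα).2.2.2.2 i j))
  -- growth and regularity of `f`
  have hfd : Differentiable ℝ f := hf.differentiable (by norm_num)
  have hpC : ∀ i, ContDiff ℝ 1 (pd i f) := fun i => KP.contDiff_pd hf i
  have hpd : ∀ i, Differentiable ℝ (pd i f) := fun i => (hpC i).differentiable (by norm_num)
  have hpc : ∀ i, Continuous (pd i f) := fun i => (hpC i).continuous
  have hp2c : ∀ i j, Continuous (pd2 i j f) := fun i j => KP.cont_pd (hpC i) j
  have hEf : KP.EB δ f := KP.growth hf.continuous hgrowf hδ0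
  have hE1 : ∀ i, KP.EB δ (pd i f) := fun i => KP.growth (hpc i) (hgrow1 i) hδ0
  have hE2 : ∀ i j, KP.EB δ (pd2 i j f) := fun i j => KP.growth (hp2c i j) (hgrow2 i j) hδ0
  set g : (Fin n →₀ ℕ) → ℝ := KP.hat d f with hg
  have hGB : KP.GB ρ g := KP.GB_hat hd hδd hEf hf.continuous
  -- second differences
  have hDD : ∀ i j m, KP.Df j (KP.Df i g) m =
      d⁻¹ * d⁻¹ * KP.hat d (pd2 i j f) (m + Finsupp.single j 1 + Finsupp.single i 1) := by
    intro i j m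
    have a1 := KP.H2 hd hδd (hE1 i) (hE2 i j) (hpc i) (hp2c i j) j (KP.upd_deriv (hpd i) j)
      (m + Finsupp.single i 1)
    have a2 := fun m => KP.H2 hd hδd hEf (hE1 i) hf.continuous (hpc i) i (KP.upd_deriv hfd i) m
    have a3 : KP.Df j (KP.hat d (pd i f)) (m + Finsupp.single i 1) =
        d * KP.Df j (KP.Df i g) m := by
      simp only [KP.Df] at a2 ⊢
      rw [add_right_comm, a2, a2]
      ring
    rw [add_right_comm, a1, a3]
    field_simp
  have hHnn : ∀ F : (Fin n → ℝ) → ℝ, (∀ l : Fin n → ℝ, (∀ i', 0 ≤ l i') → 0 ≤ F l) →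
      ∀ m, 0 ≤ KP.hat d F m := by
    intro F hF m
    refine integral_nonneg_of_ae ?_
    filter_upwards [KP.Gam_nonneg hd m] with l hl using hF l hl
  have hHnp : ∀ F : (Fin n → ℝ) → ℝ, (∀ l : Fin n → ℝ, (∀ i', 0 ≤ l i') → F l ≤ 0) →
      ∀ m, KP.hat d F m ≤ 0 := by
    intro F hF m
    refine integral_nonpos_of_ae ?_
    filter_upwards [KP.Gam_nonneg hd m] with l hl using hF l hl
  have hdiag : ∀ i m, KP.Df i g m + m i * (KP.Df i g m - KP.Df i g (m - Finsupp.single i 1)) =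
      d⁻¹ * KP.hat d (fun l => pd i f l + l i * pd2 i i f l) m := by
    intro i m
    rw [KP.H3 hd hδd hEf (hE1 i) (hE2 i i) hf.continuous (hpc i) (hp2c i i) i
      (KP.upd_deriv hfd i) (KP.upd_deriv (hpd i) i) m, ← mul_assoc, inv_mul_cancel₀ hd.ne', one_mul]
  have hdi : 0 < d⁻¹ := by positivity
  have hnegD : ∀ i m, KP.Df i (fun m => - g m) m = - KP.Df i g m := by
    intro i m; simp only [KP.Df]; ring
  have hs : ∀ α ∈ I, ∀ i j, 0 ≤ G' α i j * KP.pr (KP.UU (B α) i j) g := by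
    intro α hα i j
    by_cases hij : i = j
    · subst hij
      rcases hdiagsign i with ⟨s1, s2⟩ | ⟨s1, s2⟩
      · refine mul_nonneg (s1 α hα) (KP.pr_UU_diag_nonneg hρ1 (B α) i (hΨρ α hα) (hTρ α hα i i)
          (hΨ0 α hα) hGB fun m => ?_)
        rw [hdiag]
        exact mul_nonneg hdi.le (hHnn _ s2 m)
      · refine mul_nonneg_of_nonpos_of_nonpos (s1 α hα) ?_
        rw [← neg_nonneg, ← KP.pr_neg]
        refine KP.pr_UU_diag_nonneg hρ1 (B α) i (hΨρ α hα) (hTρ α hα i i)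
          (hΨ0 α hα) hGB.neg fun m => ?_
        have h1 := hdiag i m
        have h2 := mul_nonpos_of_nonneg_of_nonpos hdi.le (hHnp _ s2 m)
        rw [hnegD, hnegD]
        rw [← h1] at h2
        linarith
    · rcases hoffsign i j hij with ⟨s1, s2⟩ | ⟨s1, s2⟩
      · refine mul_nonneg (s1 α hα) (KP.pr_UU_off_nonneg hρ0.le (B α) hij (hΨρ α hα)
          (hTρ α hα j i) (hΨ0 α hα) (KP.NN_TT _ (hb α hα).1 j i) hGB fun m => ?_)
        rw [hDD]
        exact mul_nonneg (by positivity) (hHnn _ s2 _)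
      · refine mul_nonneg_of_nonpos_of_nonpos (s1 α hα) ?_
        rw [← neg_nonneg, ← KP.pr_neg]
        refine KP.pr_UU_off_nonneg hρ0.le (B α) hij (hΨρ α hα)
          (hTρ α hα j i) (hΨ0 α hα) (KP.NN_TT _ (hb α hα).1 j i) hGB.neg fun m => ?_
        have h1 := hDD i j m
        have h2 := mul_nonpos_of_nonneg_of_nonpos (by positivity : 0 ≤ d⁻¹ * d⁻¹)
          (hHnp _ s2 (m + Finsupp.single j 1 + Finsupp.single i 1))
        have h3 : KP.Df j (KP.Df i fun m => - g m) m = - KP.Df j (KP.Df i g) m := by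
          simp only [KP.Df]; ring
        rw [h3, h1]
        linarith
  -- the laws
  have hsum : ∀ α ∈ I, HasSum (fun m => MvPowerSeries.coeff m (KP.Psi (B α)) * g m)
      (∫ ω, f (ℓ α ω) ∂μ) := by
    intro α hα
    have hm := hmeas α
    have : IsProbabilityMeasure (μ.map (ℓ α)) := Measure.isProbabilityMeasure_map hm.aemeasurable
    have hpos' : ∀ᵐ l ∂(μ.map (ℓ α)), ∀ i, 0 ≤ l i := by
      rw [ae_map_iff hm.aemeasurable]
      · exact Eventually.of_forall fun ω i => hpos α ω i
      · have : {x : Fin n → ℝ | ∀ i, 0 ≤ x i} = Set.Ici 0 := by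
          ext x; simp [Pi.le_def]
        rw [this]; exact measurableSet_Ici
    have hlap : ∀ s : Fin n → ℝ, (∀ i, 0 ≤ s i) →
        ∫ l, Real.exp (-(∑ i, s i * l i)) ∂(μ.map (ℓ α)) = ((1 + diagonal s * G α).det)⁻¹ := by
      intro s hs
      have hcont : Continuous fun l : Fin n → ℝ => Real.exp (-(∑ i, s i * l i)) := by fun_prop
      rw [integral_map hm.aemeasurable hcont.aestronglyMeasurable]
      exact hperm α hα s hs
    have hl := KP.law hd (G α) (B α) (hinvble α hα) rfl (hQ1 α hα) (hb α hα).2.1 hpos' hlap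
    have h1 : ∫ ω, f (ℓ α ω) ∂μ = ∫ l, f l ∂(μ.map (ℓ α)) :=
      (integral_map hm.aemeasurable hf.continuous.aestronglyMeasurable).symm
    rw [h1, hl]
    refine KP.Mx_hasSum hd hδd le_rfl hEf hf.continuous (hΨ0 α hα) ?_
    refine (KP.summable_coeff hρ0.le (hΨρ α hα)).congr fun m => ?_
    rw [abs_of_nonneg (hΨ0 α hα m)]
  obtain ⟨C, hC⟩ := hGB
  have hE : P * ((1 + ENNReal.ofReal ρ') + (1 + ENNReal.ofReal ρ') * T * (1 + ENNReal.ofReal ρ'))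
      ≠ ⊤ := by
    have h1 : 1 + ENNReal.ofReal ρ' ≠ ⊤ := ENNReal.add_ne_top.2 ⟨by simp, by simp⟩
    exact ENNReal.mul_ne_top hPt (ENNReal.add_ne_top.2 ⟨h1,
      ENNReal.mul_ne_top (ENNReal.mul_ne_top h1 hTt) h1⟩)
  refine KP.mono_step (B := B) hd hρ0 hρρ hE hC hderiv hsign ?_ ?_ hs (hsum 0 hI0) (hsum 1 hI1)
  · intro α hα
    refine KP.CD_Psi (B' := d⁻¹ • ((G α)⁻¹ * G' α * (G α)⁻¹)) ?_ ?_
    · intro i j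
      have := ((hAd α hα i j).const_mul d⁻¹).const_sub ((1 : Matrix (Fin n) (Fin n) ℝ) i j)
      refine this.congr_deriv ?_
      simp [Matrix.smul_apply]
    · have : 1 - B α = d⁻¹ • (G α)⁻¹ := by simp [hBdef]
      rw [this]
      simp only [Matrix.smul_mul, Matrix.mul_smul, smul_smul]
      congr 1
      field_simp
  · intro α hα i j
    exact KP.wN_UU_le (B α) (hb α hα).2.2.2.1 (hb α hα).2.2.2.2 i j
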